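/- arXiv:2307.00087 — 9 statements merged into one kernel-verified Lean document; each statement's English description precedes it below -/
import Mathlib

section
/- Let q be a positive integer and define the real polynomials (in the variable u): P₀(u) = 8q² − 4q²(1+4q)u + 8q³u² − 16(1+q)²u^{2(q−1)} + 8(1+q)(3+2q)(1+4q)u^{2q−1} − (1+2q)(9 + 2q(7+4q)²)u^{2q} + 8q(1+4q)(4+q(5+2q))u^{2q+1} − 4q²(7+4q(2+q))u^{2(q+1)} + 8(1+q)(1+4q)u^{4q+1} − 16q(1+q)u^{2(1+2q)}; P⁺(u) = 2^{(5+4q)/(2(1+q))} q (1+q)^{1/(1+q)} (2+q) − 2^{1/(1+q)} (1+q)^{2/(1+q)} (3+2q)² u − 8√2 q u^q + 2^{(4+3q)/(2(1+q))} (1+q)^{(2+q)/(1+q)} (9+2q) u^{1+q} − 2(9+10q) u^{1+2q} + 2^{(5+4q)/(2(1+q))} q (1+q)^{1/(1+q)} u^{2(1+q)} − 4√2 q u^{2+3q}; P⁻(u) = 2^{(5+4q)/(2(1+q))} q (1+q)^{1/(1+q)} (2+q) − 2^{1/(1+q)} (1+q)^{2/(1+q)} (3+2q)² u − 8(−1)^q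 √2 q u^q + (−1)^q 2^{(4+3q)/(2(1+q))} (1+q)^{(2+q)/(1+q)} (9+2q) u^{1+q} − 2(9+10q) u^{1+2q} + 2^{(5+4q)/(2(1+q))} q (1+q)^{1/(1+q)} u^{2(1+q)} − 4(−1)^q √2 q u^{2+3q}. Assume: (C1) P₀ has no root in the open interval (2, (1+4q)/(2q)); (C2) P⁺ has at most one root, counted with multiplicity, in the open interval (0, u_{i,q}^D), where u_{i,q}^D = 2^{−1/(2(1+q))}(1+q)^{−1/(1+q)}; (C3) P⁻ has at most one root, counted with multiplicity, in the open interval (−2, 0). Then for every real ω > 0 there exist T > 0 and a nonconstant T-periodic function x : ℝ → ℝ of class C² such that at every t with x(t) ≠ 0 the second derivative x'' is differentiable at t and x'''(t) + |x(t)|^q x''(t) + (q+1)(|x(t)|^q/x(t)) x'(t)² = 0, and x(t)x''(t) − x'(t)²/2 + |x(t)|^q x(t) x'(t) = −ω² for all t. -/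
open Polynomial

/-- The polynomial `P₀` of Theorem 1.2. -/
noncomputable def chazyP0 (q : ℕ) : Polynomial ℝ :=
  C (8 * (q : ℝ) ^ 2)
  - C (4 * (q : ℝ) ^ 2 * (1 + 4 * (q : ℝ))) * X
  + C (8 * (q : ℝ) ^ 3) * X ^ 2
  - C (16 * (1 + (q : ℝ)) ^ 2) * X ^ (2 * (q - 1))
  + C (8 * (1 + (q : ℝ)) * (3 + 2 * (q : ℝ)) * (1 + 4 * (q : ℝ))) * X ^ (2 * q - 1)
  - C ((1 + 2 * (q : ℝ)) * (9 + 2 * (q : ℝ) * (7 + 4 * (q : ℝ)) ^ 2)) * X ^ (2 * q)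
  + C (8 * (q : ℝ) * (1 + 4 * (q : ℝ)) * (4 + (q : ℝ) * (5 + 2 * (q : ℝ)))) * X ^ (2 * q + 1)
  - C (4 * (q : ℝ) ^ 2 * (7 + 4 * (q : ℝ) * (2 + (q : ℝ)))) * X ^ (2 * (q + 1))
  + C (8 * (1 + (q : ℝ)) * (1 + 4 * (q : ℝ))) * X ^ (4 * q + 1)
  - C (16 * (q : ℝ) * (1 + (q : ℝ))) * X ^ (2 * (1 + 2 * q))

/-- The polynomial `P⁺` of Theorem 1.2 (real powers in the coefficients are `Real.rpow`). -/
noncomputable def chazyPplus (q : ℕ) : Polynomial ℝ :=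
  C ((2 : ℝ) ^ ((5 + 4 * (q : ℝ)) / (2 * (1 + (q : ℝ)))) * (q : ℝ)
      * (1 + (q : ℝ)) ^ ((1 : ℝ) / (1 + (q : ℝ))) * (2 + (q : ℝ)))
  - C ((2 : ℝ) ^ ((1 : ℝ) / (1 + (q : ℝ))) * (1 + (q : ℝ)) ^ ((2 : ℝ) / (1 + (q : ℝ)))
      * (3 + 2 * (q : ℝ)) ^ 2) * X
  - C (8 * Real.sqrt 2 * (q : ℝ)) * X ^ q
  + C ((2 : ℝ) ^ ((4 + 3 * (q : ℝ)) / (2 * (1 + (q : ℝ))))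
      * (1 + (q : ℝ)) ^ ((2 + (q : ℝ)) / (1 + (q : ℝ))) * (9 + 2 * (q : ℝ))) * X ^ (1 + q)
  - C (2 * (9 + 10 * (q : ℝ))) * X ^ (1 + 2 * q)
  + C ((2 : ℝ) ^ ((5 + 4 * (q : ℝ)) / (2 * (1 + (q : ℝ)))) * (q : ℝ)
      * (1 + (q : ℝ)) ^ ((1 : ℝ) / (1 + (q : ℝ)))) * X ^ (2 * (1 + q))
  - C (4 * Real.sqrt 2 * (q : ℝ)) * X ^ (2 + 3 * q)

/-- The polynomial `P⁻` of Theorem 1.2 (real powers in the coefficients are `Real.rpow`). -/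
noncomputable def chazyPminus (q : ℕ) : Polynomial ℝ :=
  C ((2 : ℝ) ^ ((5 + 4 * (q : ℝ)) / (2 * (1 + (q : ℝ)))) * (q : ℝ)
      * (1 + (q : ℝ)) ^ ((1 : ℝ) / (1 + (q : ℝ))) * (2 + (q : ℝ)))
  - C ((2 : ℝ) ^ ((1 : ℝ) / (1 + (q : ℝ))) * (1 + (q : ℝ)) ^ ((2 : ℝ) / (1 + (q : ℝ)))
      * (3 + 2 * (q : ℝ)) ^ 2) * X
  - C (8 * (-1 : ℝ) ^ q * Real.sqrt 2 * (q : ℝ)) * X ^ q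
  + C ((-1 : ℝ) ^ q * (2 : ℝ) ^ ((4 + 3 * (q : ℝ)) / (2 * (1 + (q : ℝ))))
      * (1 + (q : ℝ)) ^ ((2 + (q : ℝ)) / (1 + (q : ℝ))) * (9 + 2 * (q : ℝ))) * X ^ (1 + q)
  - C (2 * (9 + 10 * (q : ℝ))) * X ^ (1 + 2 * q)
  + C ((2 : ℝ) ^ ((5 + 4 * (q : ℝ)) / (2 * (1 + (q : ℝ)))) * (q : ℝ)
      * (1 + (q : ℝ)) ^ ((1 : ℝ) / (1 + (q : ℝ)))) * X ^ (2 * (1 + q))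
  - C (4 * (-1 : ℝ) ^ q * Real.sqrt 2 * (q : ℝ)) * X ^ (2 + 3 * q)

/-- The endpoint `u_{i,q}^D = 2^{-1/(2(1+q))} (1+q)^{-1/(1+q)}`. -/
noncomputable def chazyUiD (q : ℕ) : ℝ :=
  (2 : ℝ) ^ (-(1 : ℝ) / (2 * (1 + (q : ℝ)))) * (1 + (q : ℝ)) ^ (-(1 : ℝ) / (1 + (q : ℝ)))

open Set Filter Topology

section Calculus

variable {E : Type*} [NormedAddCommGroup E] [NormedSpace ℝ E]

lemma monotoneOn_Icc_of_hasDerivWithinAt {f f' : ℝ → ℝ} {a b : ℝ}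
    (hf : ∀ t ∈ Icc a b, HasDerivWithinAt f (f' t) (Icc a b) t)
    (h : ∀ t ∈ Icc a b, 0 ≤ f' t) : MonotoneOn f (Icc a b) :=
  monotoneOn_of_hasDerivWithinAt_nonneg (convex_Icc a b) (fun t ht ↦ (hf t ht).continuousWithinAt)
    (fun t ht ↦ (hf t (interior_subset ht)).mono interior_subset)
    (fun t ht ↦ h t (interior_subset ht))

lemma antitoneOn_Icc_of_hasDerivWithinAt {f f' : ℝ → ℝ} {a b : ℝ}
    (hf : ∀ t ∈ Icc a b, HasDerivWithinAt f (f' t) (Icc a b) t)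
    (h : ∀ t ∈ Icc a b, f' t ≤ 0) : AntitoneOn f (Icc a b) :=
  antitoneOn_of_hasDerivWithinAt_nonpos (convex_Icc a b) (fun t ht ↦ (hf t ht).continuousWithinAt)
    (fun t ht ↦ (hf t (interior_subset ht)).mono interior_subset)
    (fun t ht ↦ h t (interior_subset ht))

lemma exists_forall_lt_left_of_hasDerivWithinAt_neg {f : ℝ → ℝ} {d a b : ℝ} (hab : a < b)
    (hf : HasDerivWithinAt f d (Icc a b) a) (hd : d < 0) :
    ∃ c ∈ Ioc a b, ∀ t ∈ Ioo a c, f t < f a := by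
  have h := hasDerivWithinAt_iff_tendsto_slope.1 hf
  rw [Icc_sdiff_left] at h
  have h2 : ∀ᶠ t in 𝓝[Ioc a b] a, f t < f a := by
    filter_upwards [h.eventually (gt_mem_nhds hd), self_mem_nhdsWithin] with t ht hta
    rw [slope_def_field, div_neg_iff] at ht
    rcases ht with ht | ht <;> linarith [hta.1]
  rw [nhdsWithin_Ioc_eq_nhdsGT hab] at h2
  obtain ⟨c, hc, hc2⟩ := (mem_nhdsGT_iff_exists_mem_Ioc_Ioo_subset hab).1 h2
  exact ⟨c, hc, fun t ht ↦ hc2 ht⟩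

lemma exists_gt_right_of_hasDerivWithinAt_neg {f : ℝ → ℝ} {d a b : ℝ} (hab : a < b)
    (hf : HasDerivWithinAt f d (Icc a b) b) (hd : d < 0) :
    ∃ t ∈ Ioo a b, f b < f t := by
  have h := hasDerivWithinAt_iff_tendsto_slope.1 hf
  rw [Icc_sdiff_right] at h
  rw [nhdsWithin_Ico_eq_nhdsLT hab] at h
  have h2 : ∀ᶠ t in 𝓝[<] b, f b < f t := by
    filter_upwards [h.eventually (gt_mem_nhds hd), self_mem_nhdsWithin] with t ht hta
    rw [slope_def_field, div_neg_iff] at ht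
    rcases ht with ht | ht <;> linarith [mem_Iio.1 hta]
  obtain ⟨t, ht, ht2⟩ := (h2.and (Ioo_mem_nhdsLT hab)).exists
  exact ⟨t, ht2, ht⟩

/-- Gluing two differentiable functions along a common endpoint. -/
lemma HasDerivWithinAt.union_Icc {f f' : ℝ → ℝ} {a c b : ℝ}
    (hac : a < c) (hcb : c < b)
    (h₁ : ∀ t ∈ Icc a c, HasDerivWithinAt f (f' t) (Icc a c) t)
    (h₂ : ∀ t ∈ Icc c b, HasDerivWithinAt f (f' t) (Icc c b) t) :
    ∀ t ∈ Icc a b, HasDerivWithinAt f (f' t) (Icc a b) t := by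
  intro t ht
  rcases lt_trichotomy t c with h | rfl | h
  · refine (h₁ t ⟨ht.1, h.le⟩).mono_of_mem_nhdsWithin ?_
    filter_upwards [self_mem_nhdsWithin, mem_nhdsWithin_of_mem_nhds (Iio_mem_nhds h)] with u hu hu2
    exact ⟨hu.1, le_of_lt hu2⟩
  · rw [← Icc_union_Icc_eq_Icc hac.le hcb.le]
    exact (h₁ t ⟨hac.le, le_rfl⟩).union (h₂ t ⟨le_rfl, hcb.le⟩)
  · refine (h₂ t ⟨h.le, ht.2⟩).mono_of_mem_nhdsWithin ?_
    filter_upwards [self_mem_nhdsWithin, mem_nhdsWithin_of_mem_nhds (Ioi_mem_nhds h)] with u hu hu2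
    exact ⟨le_of_lt hu2, hu.2⟩

end Calculus

section Antiperiodic

lemma exists_antiperiodic_extension {f : ℝ → ℝ} {A P : ℝ} (hP : 0 < P) (hf : f (A + P) = -f A) :
    ∃ F : ℝ → ℝ, Function.Antiperiodic F P ∧ EqOn F f (Icc A (A + P)) := by
  have anti : Function.Antiperiodic
      (fun t ↦ (-1 : ℝ) ^ toIcoDiv hP A t * f (toIcoMod hP A t)) P := by
    intro t
    simp only [toIcoDiv_add_right, toIcoMod_add_right]
    rw [zpow_add_one₀ (by norm_num)]
    ring
  have h0 : ∀ t ∈ Ico A (A + P), (-1 : ℝ) ^ toIcoDiv hP A t * f (toIcoMod hP A t) = f t := by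
    intro t ht
    have h1 : toIcoMod hP A t = t := (toIcoMod_eq_self hP).2 ht
    have h2 : toIcoDiv hP A t = 0 := toIcoDiv_eq_of_sub_zsmul_mem_Ico hP (by simpa using ht)
    rw [h1, h2]; simp
  refine ⟨_, anti, fun t ht ↦ ?_⟩
  rcases ht.2.lt_or_eq with h | rfl
  · exact h0 t ⟨ht.1, h⟩
  · have h1 := anti A
    beta_reduce at h1 ⊢
    rw [h1, hf, h0 A ⟨le_rfl, by linarith⟩]

lemma Function.Antiperiodic.neg_sub_eq {F : ℝ → ℝ} {P : ℝ} (hF : Function.Antiperiodic F P)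
    (u : ℝ) : -F (u - P) = F u := by
  have := hF (u - P)
  rw [sub_add_cancel] at this
  exact this.symm

lemma hasDerivAt_of_antiperiodic {F G : ℝ → ℝ} {A P : ℝ} (hP : 0 < P)
    (hF : Function.Antiperiodic F P) (hG : Function.Antiperiodic G P)
    (h : ∀ t ∈ Icc A (A + P), HasDerivWithinAt F (G t) (Icc A (A + P)) t) (t : ℝ) :
    HasDerivAt F (G t) t := by
  have h2 : ∀ t ∈ Icc (A + P) (A + P + P),
      HasDerivWithinAt F (G t) (Icc (A + P) (A + P + P)) t := by
    intro t ht
    have h3 := h (t - P) ⟨by linarith [ht.1], by linarith [ht.2]⟩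
    have h4 : HasDerivWithinAt (fun u ↦ -F (u - P)) (-G (t - P)) (Icc (A + P) (A + P + P)) t := by
      have hm : MapsTo (fun u ↦ u - P) (Icc (A + P) (A + P + P)) (Icc A (A + P)) :=
        fun u hu ↦ ⟨by linarith [hu.1], by linarith [hu.2]⟩
      have h5 := (h3.comp t ((hasDerivWithinAt_id t (Icc (A + P) (A + P + P))).sub_const P) hm).neg
      simpa [Function.comp_def] using! h5
    simpa only [hF.neg_sub_eq, hG.neg_sub_eq] using h4
  have h5 := HasDerivWithinAt.union_Icc (by linarith) (by linarith) h h2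
  have per : Function.Periodic (fun t ↦ HasDerivAt F (G t) t) P := by
    intro t
    simp only [eq_iff_iff]
    constructor
    · intro h
      have h6 : HasDerivAt (fun u ↦ -F (u + P)) (-G (t + P)) t := (h.comp_add_const t P).neg
      simpa only [hF _, hG _, neg_neg] using h6
    · intro h
      have h6 : HasDerivAt F (G t) (t + P + -P) := by simpa using h
      have h7 := (h6.comp_add_const (t + P) (-P)).neg
      rw [← hG t] at h7
      simpa only [← sub_eq_add_neg, Pi.neg_def, hF.neg_sub_eq] using h7
  obtain ⟨u, hu, hu2⟩ := per.exists_mem_Ioc hP t A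
  have : HasDerivAt F (G u) u := (h5 u ⟨hu.1.le, by linarith [hu.2]⟩).hasDerivAt
    (Icc_mem_nhds hu.1 (by linarith [hu.2]))
  exact hu2.mpr this

lemma continuous_of_antiperiodic {F : ℝ → ℝ} {A P : ℝ} (hP : 0 < P)
    (hF : Function.Antiperiodic F P) (h : ContinuousOn F (Icc A (A + P))) : Continuous F := by
  have h2 : ContinuousOn F (Icc (A + P) (A + P + P)) := by
    have h3 : ContinuousOn (fun u ↦ -F (u - P)) (Icc (A + P) (A + P + P)) :=
      (h.comp (by fun_prop) (fun u hu ↦ ⟨by linarith [hu.1], by linarith [hu.2]⟩)).neg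
    simpa only [hF.neg_sub_eq] using h3
  have h5 : ContinuousOn F (Icc A (A + P + P)) := by
    rw [← Icc_union_Icc_eq_Icc (b := A + P) (by linarith) (by linarith)]
    exact h.union_of_isClosed h2 isClosed_Icc isClosed_Icc
  rw [continuous_iff_continuousAt]
  intro t
  have per : Function.Periodic (fun t ↦ ContinuousAt F t) P := by
    intro t
    simp only [eq_iff_iff]
    constructor
    · intro h
      have h6 : ContinuousAt (fun u ↦ -F (u + P)) t :=
        (ContinuousAt.comp (f := fun u ↦ u + P) h (by fun_prop)).neg
      simpa only [hF _, neg_neg] using h6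
    · intro h
      have h6 : ContinuousAt (fun u ↦ -F (u - P)) (t + P) :=
        (ContinuousAt.comp (f := fun u ↦ u - P) (x := t + P) (by simpa using h) (by fun_prop)).neg
      simpa only [hF.neg_sub_eq] using h6
  obtain ⟨u, hu, hu2⟩ := per.exists_mem_Ioc hP t A
  have : ContinuousAt F u := h5.continuousAt (Icc_mem_nhds hu.1 (by linarith [hu.2]))
  exact hu2.mpr this

end Antiperiodic

section Flow

/-- Coordinatewise truncation of `ℝ³` to the cube of half-side `R`. -/
noncomputable def clampCube (R : ℝ) (p : ℝ × ℝ × ℝ) : ℝ × ℝ × ℝ :=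
  (max (-R) (min R p.1), max (-R) (min R p.2.1), max (-R) (min R p.2.2))

lemma lipschitzWith_clampCube (R : ℝ) : LipschitzWith 1 (clampCube R) := by
  have h : LipschitzWith 1 (fun u : ℝ ↦ max (-R) (min R u)) :=
    (LipschitzWith.id.const_min R).const_max (-R)
  have := (h.comp (LipschitzWith.prod_fst (α := ℝ) (β := ℝ × ℝ))).prodMk
    ((h.comp ((LipschitzWith.prod_fst (α := ℝ) (β := ℝ)).comp
      (LipschitzWith.prod_snd (α := ℝ) (β := ℝ × ℝ)))).prodMk
    (h.comp ((LipschitzWith.prod_snd (α := ℝ) (β := ℝ)).comp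
      (LipschitzWith.prod_snd (α := ℝ) (β := ℝ × ℝ)))))
  simpa [clampCube] using! this

lemma abs_clamp_le_left {R u : ℝ} (hR : 0 ≤ R) : |max (-R) (min R u)| ≤ R :=
  abs_le.2 ⟨le_max_left _ _, max_le (by linarith) (min_le_left _ _)⟩

lemma abs_clamp_le_right {R u : ℝ} (hR : 0 ≤ R) : |max (-R) (min R u)| ≤ |u| := by
  rw [abs_le]
  constructor
  · rcases le_total R u with h | h
    · rw [min_eq_left h]
      exact le_max_of_le_right (by linarith [abs_nonneg u])
    · rw [min_eq_right h]
      exact le_max_of_le_right (neg_abs_le u)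
  · exact max_le (by linarith [abs_nonneg u]) ((min_le_right _ _).trans (le_abs_self u))

lemma norm_clampCube_le_left {R : ℝ} (hR : 0 ≤ R) (p : ℝ × ℝ × ℝ) : ‖clampCube R p‖ ≤ R :=
  max_le (abs_clamp_le_left hR) (max_le (abs_clamp_le_left hR) (abs_clamp_le_left hR))

lemma norm_clampCube_le_right {R : ℝ} (hR : 0 ≤ R) (p : ℝ × ℝ × ℝ) : ‖clampCube R p‖ ≤ ‖p‖ :=
  max_le_max (abs_clamp_le_right hR)
    (max_le_max (abs_clamp_le_right hR) (abs_clamp_le_right hR))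

lemma clamp_eq_self {R u : ℝ} (h : |u| ≤ R) : max (-R) (min R u) = u := by
  rw [min_eq_right (abs_le.1 h).2, max_eq_right (abs_le.1 h).1]

lemma clampCube_eq_self {R : ℝ} {p : ℝ × ℝ × ℝ} (h : ‖p‖ ≤ R) : clampCube R p = p := by
  have h2 := (norm_snd_le p).trans h
  simp [clampCube, clamp_eq_self ((norm_fst_le p).trans h),
    clamp_eq_self ((norm_fst_le p.2).trans h2), clamp_eq_self ((norm_snd_le p.2).trans h2)]

/-- A locally Lipschitz vector field on `ℝ³` of linear growth has a continuous flow up to any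
time. -/
lemma exists_flow_of_linear_growth {F : ℝ × ℝ × ℝ → ℝ × ℝ × ℝ} (hF : LocallyLipschitz F)
    {B A : ℝ} (hB : 0 ≤ B) (hA : 0 ≤ A) (hbd : ∀ p, ‖F p‖ ≤ B * ‖p‖ + A)
    {T r : ℝ} (hT : 0 ≤ T) (hr : 0 ≤ r) :
    ∃ α : (ℝ × ℝ × ℝ) × ℝ → ℝ × ℝ × ℝ,
      (∀ p ∈ Metric.closedBall (0 : ℝ × ℝ × ℝ) r, α (p, 0) = p ∧
        ∀ t ∈ Icc 0 T, HasDerivWithinAt (fun u ↦ α (p, u)) (F (α (p, t))) (Icc 0 T) t) ∧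
      ContinuousOn α (Metric.closedBall 0 r ×ˢ Icc 0 T) := by
  set R := gronwallBound r B A T with hRdef
  have hmono := gronwallBound_mono hr hA hB
  have hR : 0 ≤ R := by
    have := hmono hT
    rw [gronwallBound_x0] at this
    exact hr.trans this
  have hG : LocallyLipschitz (fun p ↦ F (clampCube R p)) :=
    hF.comp (lipschitzWith_clampCube R).locallyLipschitz
  have hGb : ∀ p, ‖F (clampCube R p)‖ ≤ B * R + A := fun p ↦
    (hbd _).trans (by gcongr; exact norm_clampCube_le_left hR p)
  have hL : 0 ≤ B * R + A := by positivity
  have ha : 0 ≤ r + (B * R + A) * T := by positivity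
  obtain ⟨K, hK⟩ := (hG.locallyLipschitzOn (s := Metric.closedBall 0 (r + (B * R + A) * T)))
    |>.exists_lipschitzOnWith_of_compact (isCompact_closedBall _ _)
  have pl : IsPicardLindelof (fun _ : ℝ ↦ fun p ↦ F (clampCube R p)) (tmin := 0) (tmax := T)
      ⟨0, le_rfl, hT⟩ (0 : ℝ × ℝ × ℝ) ⟨r + (B * R + A) * T, ha⟩ ⟨r, hr⟩ ⟨B * R + A, hL⟩ K :=
    { lipschitzOnWith := fun _ _ ↦ hK
      continuousOn := fun _ _ ↦ continuousOn_const
      norm_le := fun _ _ p _ ↦ hGb p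
      mul_max_le := by
        simp only [sub_zero, sub_self, max_eq_left hT]
        change (B * R + A) * T ≤ r + (B * R + A) * T - r
        linarith }
  obtain ⟨α, hα, hc⟩ := pl.exists_forall_mem_closedBall_eq_hasDerivWithinAt_continuousOn
  refine ⟨α, fun p hp ↦ ⟨(hα p hp).1, fun t ht ↦ ?_⟩, hc⟩
  have hd := (hα p hp).2
  have hp0 : α (p, 0) = p := (hα p hp).1
  have hb := norm_le_gronwallBound_of_norm_deriv_right_le (f := fun u ↦ α (p, u))
    (f' := fun u ↦ F (clampCube R (α (p, u)))) (δ := r) (K := B) (ε := A) (a := 0) (b := T)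
    (fun u hu ↦ (hd u hu).continuousWithinAt)
    (fun u hu ↦ (hd u ⟨hu.1, hu.2.le⟩).mono_of_mem_nhdsWithin (Icc_mem_nhdsGE_of_mem hu))
    (by simpa [hp0] using! hp)
    (fun u _ ↦ (hbd _).trans (by gcongr; exact norm_clampCube_le_right hR _)) t ht
  have hle : ‖α (p, t)‖ ≤ R := hb.trans (hmono (by linarith [ht.2]))
  have := hd t ht
  simpa only [clampCube_eq_self hle] using this

end Flow

section Descent

/-- The branch of the orbit of `x' = y`, `y' = s - ε xⁿ⁺¹ y`, `s' = -ε xⁿ y²` on the level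
`2 x s = y² - κ²` that descends from its highest point `x = m` during the time `τ`, while
remaining in `x ≥ 0`. -/
structure IsDescent (n : ℕ) (ε κ m τ : ℝ) (x y s : ℝ → ℝ) : Prop where
  pos : 0 < τ
  hx : ∀ t ∈ Icc 0 τ, HasDerivWithinAt x (y t) (Icc 0 τ) t
  hy : ∀ t ∈ Icc 0 τ, HasDerivWithinAt y (s t - ε * x t ^ (n + 1) * y t) (Icc 0 τ) t
  hs : ∀ t ∈ Icc 0 τ, HasDerivWithinAt s (-ε * x t ^ n * y t ^ 2) (Icc 0 τ) t
  x_zero : x 0 = m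
  y_zero : y 0 = 0
  s_zero : s 0 = -κ ^ 2 / (2 * m)
  nonneg : ∀ t ∈ Icc 0 τ, 0 ≤ x t
  neg : ∀ t ∈ Ioc 0 τ, y t < 0
  inv : ∀ t ∈ Icc 0 τ, 2 * x t * s t = y t ^ 2 - κ ^ 2

namespace IsDescent

variable {n : ℕ} {ε κ m τ : ℝ} {x y s : ℝ → ℝ}

lemma nonpos (h : IsDescent n ε κ m τ x y s) : ∀ t ∈ Icc 0 τ, y t ≤ 0 := by
  intro t ht
  rcases ht.1.eq_or_lt with rfl | h0
  · exact h.y_zero.le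
  · exact (h.neg t ⟨h0, ht.2⟩).le

lemma strictAntiOn (h : IsDescent n ε κ m τ x y s) : StrictAntiOn x (Icc 0 τ) := by
  refine strictAntiOn_of_hasDerivWithinAt_neg (convex_Icc 0 τ)
    (fun t ht ↦ (h.hx t ht).continuousWithinAt)
    (fun t ht ↦ (h.hx t (interior_subset ht)).mono interior_subset) (fun t ht ↦ ?_)
  rw [interior_Icc] at ht
  exact h.neg t ⟨ht.1, ht.2.le⟩

lemma le_top (h : IsDescent n ε κ m τ x y s) : ∀ t ∈ Icc 0 τ, x t ≤ m := by
  intro t ht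
  rw [← h.x_zero]
  exact h.strictAntiOn.antitoneOn ⟨le_rfl, h.pos.le⟩ ht ht.1

lemma continuousOn_x (h : IsDescent n ε κ m τ x y s) : ContinuousOn x (Icc 0 τ) :=
  fun t ht ↦ (h.hx t ht).continuousWithinAt

lemma continuousOn_s (h : IsDescent n ε κ m τ x y s) : ContinuousOn s (Icc 0 τ) :=
  fun t ht ↦ (h.hs t ht).continuousWithinAt

lemma zero_mem (h : IsDescent n ε κ m τ x y s) : (0 : ℝ) ∈ Icc 0 τ := ⟨le_rfl, h.pos.le⟩

lemma end_mem (h : IsDescent n ε κ m τ x y s) : τ ∈ Icc 0 τ := ⟨h.pos.le, le_rfl⟩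

lemma mono (h : IsDescent n ε κ m τ x y s) {t : ℝ} (ht : t ∈ Ioc 0 τ) :
    IsDescent n ε κ m t x y s := by
  have hsub : Icc 0 t ⊆ Icc 0 τ := Icc_subset_Icc le_rfl ht.2
  exact
    { pos := ht.1
      hx := fun u hu ↦ (h.hx u (hsub hu)).mono hsub
      hy := fun u hu ↦ (h.hy u (hsub hu)).mono hsub
      hs := fun u hu ↦ (h.hs u (hsub hu)).mono hsub
      x_zero := h.x_zero
      y_zero := h.y_zero
      s_zero := h.s_zero
      nonneg := fun u hu ↦ h.nonneg u (hsub hu)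
      neg := fun u hu ↦ h.neg u ⟨hu.1, hu.2.trans ht.2⟩
      inv := fun u hu ↦ h.inv u (hsub hu) }

lemma y_end (h : IsDescent n ε κ m τ x y s) (hκ : 0 < κ) (hz : x τ = 0) : y τ = -κ := by
  have h1 := h.inv τ h.end_mem
  have h2 := h.neg τ ⟨h.pos, le_rfl⟩
  rw [hz] at h1
  have h3 : (y τ + κ) * (y τ - κ) = 0 := by linarith
  rcases mul_eq_zero.1 h3 with h4 | h4 <;> linarith

/-- Where `s ≤ 0` the speed is at most `κ`. -/
lemma neg_le_y (h : IsDescent n ε κ m τ x y s) (hκ : 0 < κ) {t : ℝ} (ht : t ∈ Icc 0 τ)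
    (hst : s t ≤ 0) : -κ ≤ y t := by
  have h1 := h.inv t ht
  have h2 : x t * s t ≤ 0 := mul_nonpos_of_nonneg_of_nonpos (h.nonneg t ht) hst
  exact (abs_le.1 (abs_le_of_sq_le_sq (by linarith) hκ.le)).1

/-! ### Descent with damping -/

lemma antitoneOn_s (h : IsDescent n 1 κ m τ x y s) : AntitoneOn s (Icc 0 τ) :=
  antitoneOn_Icc_of_hasDerivWithinAt h.hs fun t ht ↦ by
    have := mul_nonneg (pow_nonneg (h.nonneg t ht) n) (sq_nonneg (y t))
    linarith

lemma s_le (h : IsDescent n 1 κ m τ x y s) {t : ℝ} (ht : t ∈ Icc 0 τ) :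
    s t ≤ -κ ^ 2 / (2 * m) := by
  rw [← h.s_zero]
  exact h.antitoneOn_s h.zero_mem ht ht.1

lemma s_nonpos (h : IsDescent n 1 κ m τ x y s) (hm : 0 < m) {t : ℝ} (ht : t ∈ Icc 0 τ) :
    s t ≤ 0 :=
  (h.s_le ht).trans (div_nonpos_of_nonpos_of_nonneg (by nlinarith) (by linarith))

lemma time_le (h : IsDescent n 1 κ m τ x y s) (hκ : 0 < κ) (hm : 0 < m) :
    τ ≤ 2 * m * (κ + m ^ (n + 2)) / κ ^ 2 := by
  have key : AntitoneOn (fun t ↦ y t + x t ^ (n + 2) / (n + 2) + κ ^ 2 / (2 * m) * t)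
      (Icc 0 τ) := by
    refine antitoneOn_Icc_of_hasDerivWithinAt
      (f' := fun t ↦ s t - 1 * x t ^ (n + 1) * y t + ((n + 2 : ℕ) : ℝ) * x t ^ (n + 1) * y t
        / (n + 2) + κ ^ 2 / (2 * m) * 1) (fun t ht ↦ ?_) (fun t ht ↦ ?_)
    · exact ((h.hy t ht).add (((h.hx t ht).pow (n + 2)).div_const _)).add
        ((hasDerivWithinAt_id t _).const_mul _)
    · have h1 := h.s_le ht
      have h2 : ((n + 2 : ℕ) : ℝ) * x t ^ (n + 1) * y t / (n + 2) = x t ^ (n + 1) * y t := by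
        push_cast
        field_simp
      rw [h2]
      have h3 : -κ ^ 2 / (2 * m) = -(κ ^ 2 / (2 * m)) := by ring
      linarith
  have h1 := key h.zero_mem h.end_mem h.pos.le
  simp only [h.x_zero, h.y_zero] at h1
  have h2 := h.neg_le_y hκ h.end_mem (h.s_nonpos hm h.end_mem)
  have h3 : 0 ≤ x τ ^ (n + 2) / (n + 2) := by
    have := h.nonneg τ h.end_mem
    positivity
  have h4 : m ^ (n + 2) / (n + 2) ≤ m ^ (n + 2) := div_le_self (by positivity) (by
    have : (0 : ℝ) ≤ n := n.cast_nonneg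
    linarith)
  have h5 : κ ^ 2 / (2 * m) * τ ≤ κ + m ^ (n + 2) := by linarith
  rw [le_div_iff₀ (by positivity)]
  calc τ * κ ^ 2 = 2 * m * (κ ^ 2 / (2 * m) * τ) := by field_simp
    _ ≤ _ := by gcongr

lemma le_s_end (h : IsDescent n 1 κ m τ x y s) (hκ : 0 < κ) (hm : 1 ≤ m) (hz : x τ = 0) :
    -κ ^ 2 / 2 - κ ≤ s τ := by
  have key : MonotoneOn (fun t ↦ s t - κ * (x t ^ (n + 1) / (n + 1))) (Icc 0 τ) := by
    refine monotoneOn_Icc_of_hasDerivWithinAt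
      (f' := fun t ↦ -1 * x t ^ n * y t ^ 2 - κ * (((n + 1 : ℕ) : ℝ) * x t ^ n * y t / (n + 1)))
      (fun t ht ↦ ?_) (fun t ht ↦ ?_)
    · exact (h.hs t ht).sub ((((h.hx t ht).pow (n + 1)).div_const _).const_mul κ)
    · have h1 := h.neg_le_y hκ ht (h.s_nonpos (by linarith) ht)
      have h2 : ((n + 1 : ℕ) : ℝ) * x t ^ n * y t / (n + 1) = x t ^ n * y t := by
        push_cast
        field_simp
      rw [h2]
      have := mul_nonneg (mul_nonneg (pow_nonneg (h.nonneg t ht) n)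
        (neg_nonneg.2 (h.nonpos t ht))) (by linarith : 0 ≤ y t + κ)
      linarith
  obtain ⟨t, ht, hxt⟩ : (1 : ℝ) ∈ x '' Icc 0 τ :=
    intermediate_value_Icc' h.pos.le h.continuousOn_x ⟨by rw [hz]; norm_num, by rwa [h.x_zero]⟩
  have h1 := key ht h.end_mem ht.2
  have h2 := h.inv t ht
  simp only [hz, hxt, one_pow] at h1 h2
  have h3 : (1 : ℝ) / (n + 1) ≤ 1 := div_le_self (by norm_num) (by
    have : (0 : ℝ) ≤ n := n.cast_nonneg
    linarith)
  have h4 : κ * (1 / ((n : ℝ) + 1)) ≤ κ * 1 := by gcongr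
  rw [zero_pow (by omega), zero_div, mul_zero] at h1
  nlinarith [sq_nonneg (y t)]

/-! ### Descent with antidamping -/

lemma monotoneOn_s (h : IsDescent n (-1) κ m τ x y s) : MonotoneOn s (Icc 0 τ) :=
  monotoneOn_Icc_of_hasDerivWithinAt h.hs fun t ht ↦ by
    have := mul_nonneg (pow_nonneg (h.nonneg t ht) n) (sq_nonneg (y t))
    linarith

lemma le_sq_y (h : IsDescent n (-1) κ m τ x y s) (hm : 0 < m) {t : ℝ} (ht : t ∈ Icc 0 τ) :
    κ ^ 2 * (1 - x t / m) ≤ y t ^ 2 := by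
  have h1 := h.monotoneOn_s h.zero_mem ht ht.1
  rw [h.s_zero] at h1
  have h2 := h.inv t ht
  have h3 : 2 * x t * (-κ ^ 2 / (2 * m)) ≤ 2 * x t * s t :=
    mul_le_mul_of_nonneg_left h1 (by linarith [h.nonneg t ht])
  have h4 : 2 * x t * (-κ ^ 2 / (2 * m)) = -(κ ^ 2 * (x t / m)) := by field_simp
  linarith

lemma height_nonneg (h : IsDescent n ε κ m τ x y s) (hm : 0 < m) {t : ℝ} (ht : t ∈ Icc 0 τ) :
    0 ≤ 1 - x t / m := by
  have := (div_le_one hm).2 (h.le_top t ht)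
  linarith

lemma mul_sqrt_le (h : IsDescent n (-1) κ m τ x y s) (hm : 0 < m) {t : ℝ}
    (ht : t ∈ Icc 0 τ) : κ * √(1 - x t / m) ≤ -y t := by
  refine le_of_sq_le_sq ?_ (by linarith [h.nonpos t ht])
  rw [mul_pow, Real.sq_sqrt (h.height_nonneg hm ht)]
  linarith [h.le_sq_y hm ht]

lemma time_le' (h : IsDescent n (-1) κ m τ x y s) (hκ : 0 < κ) (hm : 0 < m) :
    τ ≤ 2 * m / κ := by
  have hu : ∀ t ∈ Ioo 0 τ, 0 < 1 - x t / m := by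
    intro t ht
    have h1 := h.strictAntiOn h.zero_mem ⟨ht.1.le, ht.2.le⟩ ht.1
    rw [h.x_zero] at h1
    have := (div_lt_one hm).2 h1
    linarith
  have key : MonotoneOn (fun t ↦ √(1 - x t / m) - κ / (2 * m) * t) (Icc 0 τ) := by
    refine monotoneOn_of_hasDerivWithinAt_nonneg (convex_Icc 0 τ)
      (f' := fun t ↦ -(y t / m) / (2 * √(1 - x t / m)) - κ / (2 * m) * 1) ?_
      (fun t ht ↦ ?_) (fun t ht ↦ ?_)
    · have := h.continuousOn_x
      fun_prop
    · rw [interior_Icc] at ht ⊢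
      have h1 := (h.hx t ⟨ht.1.le, ht.2.le⟩).mono Ioo_subset_Icc_self
      exact (((h1.div_const m).const_sub 1).sqrt (hu t ht).ne').sub
        ((hasDerivWithinAt_id t _).const_mul _)
    · rw [interior_Icc] at ht
      have h1 := Real.sqrt_pos.2 (hu t ht)
      have h2 := h.mul_sqrt_le hm ⟨ht.1.le, ht.2.le⟩
      have h3 : -(y t / m) / (2 * √(1 - x t / m)) = (-y t) / √(1 - x t / m) / (2 * m) := by
        field_simp
      have h4 : κ ≤ (-y t) / √(1 - x t / m) := (le_div_iff₀ h1).2 h2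
      rw [h3, mul_one, ← sub_div]
      exact div_nonneg (by linarith) (by linarith)
  have h1 := key h.zero_mem h.end_mem h.pos.le
  have h2 : √(1 - x τ / m) ≤ 1 := by
    rw [Real.sqrt_le_one]
    have := div_nonneg (h.nonneg τ h.end_mem) hm.le
    linarith
  simp only [h.x_zero, div_self hm.ne', sub_self, Real.sqrt_zero, mul_zero] at h1
  have h3 : κ / (2 * m) * τ ≤ 1 := by linarith
  rw [le_div_iff₀ hκ]
  calc τ * κ = 2 * m * (κ / (2 * m) * τ) := by field_simp
    _ ≤ 2 * m * 1 := by gcongr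
    _ = _ := by ring

lemma le_s_end' (h : IsDescent n (-1) κ m τ x y s) (hκ : 0 < κ) (hm : 0 < m) (hz : x τ = 0) :
    -κ ^ 2 / (2 * m) + κ * m ^ (n + 1) / ((n + 1) * (n + 2)) ≤ s τ := by
  have key : MonotoneOn (fun t ↦ s t
      + κ * (x t ^ (n + 1) / (n + 1) - x t ^ (n + 2) / (n + 2) / m)) (Icc 0 τ) := by
    refine monotoneOn_Icc_of_hasDerivWithinAt
      (f' := fun t ↦ -(-1) * x t ^ n * y t ^ 2 + κ * (((n + 1 : ℕ) : ℝ) * x t ^ n * y t / (n + 1)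
        - ((n + 2 : ℕ) : ℝ) * x t ^ (n + 1) * y t / (n + 2) / m))
      (fun t ht ↦ ?_) (fun t ht ↦ ?_)
    · exact (h.hs t ht).add (((((h.hx t ht).pow (n + 1)).div_const _).sub
        ((((h.hx t ht).pow (n + 2)).div_const _).div_const m)).const_mul κ)
    · have h1 : κ * (1 - x t / m) ≤ -y t := by
        refine le_trans ?_ (h.mul_sqrt_le hm ht)
        gcongr
        have h5 := h.height_nonneg hm ht
        refine Real.le_sqrt_of_sq_le ?_
        have := div_nonneg (h.nonneg t ht) hm.le
        nlinarith
      have h2 : ((n + 1 : ℕ) : ℝ) * x t ^ n * y t / (n + 1) = x t ^ n * y t := by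
        push_cast
        field_simp
      have h3 : ((n + 2 : ℕ) : ℝ) * x t ^ (n + 1) * y t / (n + 2) / m
          = x t ^ n * y t * (x t / m) := by
        push_cast
        field_simp
        ring
      rw [h2, h3]
      have := mul_nonneg (mul_nonneg (pow_nonneg (h.nonneg t ht) n)
        (neg_nonneg.2 (h.nonpos t ht))) (by linarith : 0 ≤ -y t - κ * (1 - x t / m))
      linarith
  have h1 := key h.zero_mem h.end_mem h.pos.le
  simp only [h.x_zero, h.s_zero, hz] at h1
  rw [zero_pow (by omega), zero_pow (by omega)] at h1
  have h2 : m ^ (n + 1) / ((n : ℝ) + 1) - m ^ (n + 2) / (n + 2) / m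
      = m ^ (n + 1) / ((n + 1) * (n + 2)) := by
    field_simp
    ring
  rw [h2] at h1
  have h3 : κ * m ^ (n + 1) / (((n : ℝ) + 1) * (n + 2))
      = κ * (m ^ (n + 1) / ((n + 1) * (n + 2))) := by ring
  rw [h3]
  simpa using h1

lemma s_end_nonpos (h : IsDescent n (-1) κ m τ x y s) (hκ : 0 < κ) (hm : 0 < m) (hm1 : m ≤ 1)
    (hmκ : m ≤ κ / 4) : s τ ≤ 0 := by
  by_contra! hpos
  have h0 : s 0 < 0 := by
    rw [h.s_zero]
    exact div_neg_of_neg_of_pos (by nlinarith) (by linarith)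
  obtain ⟨t, ht, hst⟩ : (0 : ℝ) ∈ s '' Icc 0 τ :=
    intermediate_value_Icc h.pos.le h.continuousOn_s ⟨h0.le, hpos.le⟩
  have ht0 : 0 < t := by
    rcases ht.1.eq_or_lt with rfl | h1
    · linarith
    · exact h1
  have h' := h.mono ⟨ht0, ht.2⟩
  have key : AntitoneOn (fun t ↦ s t + κ * (x t ^ (n + 1) / (n + 1))) (Icc 0 t) := by
    refine antitoneOn_Icc_of_hasDerivWithinAt
      (f' := fun t ↦ -(-1) * x t ^ n * y t ^ 2
        + κ * (((n + 1 : ℕ) : ℝ) * x t ^ n * y t / (n + 1)))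
      (fun u hu ↦ ?_) (fun u hu ↦ ?_)
    · exact (h'.hs u hu).add ((((h'.hx u hu).pow (n + 1)).div_const _).const_mul κ)
    · have h1 := h'.neg_le_y hκ hu (by
        rw [← hst]; exact h'.monotoneOn_s hu h'.end_mem hu.2)
      have h2 : ((n + 1 : ℕ) : ℝ) * x u ^ n * y u / (n + 1) = x u ^ n * y u := by
        push_cast
        field_simp
      rw [h2]
      have := mul_nonneg (mul_nonneg (pow_nonneg (h'.nonneg u hu) n)
        (neg_nonneg.2 (h'.nonpos u hu))) (by linarith : 0 ≤ y u + κ)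
      linarith
  have h1 := key h'.zero_mem h'.end_mem h'.pos.le
  simp only [h.x_zero, h.s_zero, hst] at h1
  have hx := h'.nonneg t h'.end_mem
  have h2 : 0 ≤ κ * (x t ^ (n + 1) / (n + 1)) := by positivity
  have h3 : m ^ (n + 1) / ((n : ℝ) + 1) ≤ 1 :=
    (div_le_self (by positivity) (by
      have : (0 : ℝ) ≤ n := n.cast_nonneg
      linarith)).trans (pow_le_one₀ hm.le hm1)
  have h4 : κ * (m ^ (n + 1) / ((n : ℝ) + 1)) ≤ κ * 1 := by gcongr
  have h5 : 2 * κ ≤ κ ^ 2 / (2 * m) := by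
    rw [le_div_iff₀ (by linarith)]
    nlinarith
  have h6 : -κ ^ 2 / (2 * m) = -(κ ^ 2 / (2 * m)) := by ring
  linarith

end IsDescent

end Descent

section Clamped

/-- The vector field `(y, s - ε xⁿ⁺¹ y, -ε xⁿ y²)` restricted to the level `2 x s = y² - κ²`,
with the coordinate `x` truncated to `[0, b]` so as to have linear growth. -/
noncomputable def clampedField (n : ℕ) (ε κ b : ℝ) (p : ℝ × ℝ × ℝ) : ℝ × ℝ × ℝ :=
  (p.2.1, p.2.2 - ε * max 0 (min b p.1) ^ (n + 1) * p.2.1,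
    -ε * max 0 (min b p.1) ^ n * (κ ^ 2 + 2 * max 0 (min b p.1) * p.2.2))

lemma locallyLipschitz_clampedField (n : ℕ) (ε κ b : ℝ) :
    LocallyLipschitz (clampedField n ε κ b) := by
  have h1 : LocallyLipschitz (fun p : ℝ × ℝ × ℝ ↦ ((p.2.1, p.2.2 - ε * p.1 ^ (n + 1) * p.2.1,
      -ε * p.1 ^ n * (κ ^ 2 + 2 * p.1 * p.2.2)) : ℝ × ℝ × ℝ)) :=
    ContDiff.locallyLipschitz (𝕂 := ℝ) (by fun_prop)
  have h2 : LipschitzWith 1 (fun p : ℝ × ℝ × ℝ ↦ (max 0 (min b p.1), p.2)) := by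
    have h : LipschitzWith 1 (fun u : ℝ ↦ max 0 (min b u)) :=
      (LipschitzWith.id.const_min b).const_max 0
    simpa using! (h.comp (LipschitzWith.prod_fst (α := ℝ) (β := ℝ × ℝ))).prodMk
      (LipschitzWith.prod_snd (α := ℝ) (β := ℝ × ℝ))
  exact h1.comp h2.locallyLipschitz

lemma norm_clampedField_le (n : ℕ) {ε κ b : ℝ} (hε : |ε| = 1) (hb : 0 ≤ b) (p : ℝ × ℝ × ℝ) :
    ‖clampedField n ε κ b p‖ ≤ (1 + 2 * b ^ (n + 1)) * ‖p‖ + b ^ n * κ ^ 2 := by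
  obtain ⟨x, y, s⟩ := p
  have hy : |y| ≤ ‖(x, y, s)‖ := (norm_fst_le (y, s)).trans (norm_snd_le (x, y, s))
  have hs : |s| ≤ ‖(x, y, s)‖ := (norm_snd_le (y, s)).trans (norm_snd_le (x, y, s))
  set N := ‖(x, y, s)‖
  have hN : 0 ≤ N := norm_nonneg _
  have hc0 : 0 ≤ max 0 (min b x) := le_max_left _ _
  have hcb : max 0 (min b x) ≤ b := max_le hb (min_le_left _ _)
  simp only [clampedField]
  set c := max 0 (min b x)
  have hbn : 0 ≤ b ^ n * κ ^ 2 := by positivity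
  have hbN : 0 ≤ b ^ (n + 1) * N := by positivity
  refine max_le ?_ (max_le ?_ ?_)
  · simp only [Real.norm_eq_abs]
    linarith
  · simp only [Real.norm_eq_abs]
    calc |s - ε * c ^ (n + 1) * y| ≤ |s| + |ε * c ^ (n + 1) * y| := abs_sub _ _
      _ = |s| + c ^ (n + 1) * |y| := by
        rw [abs_mul, abs_mul, hε, one_mul, abs_of_nonneg (pow_nonneg hc0 _)]
      _ ≤ N + b ^ (n + 1) * N := by gcongr
      _ ≤ _ := by linarith
  · simp only [Real.norm_eq_abs]
    calc |-ε * c ^ n * (κ ^ 2 + 2 * c * s)| = c ^ n * |κ ^ 2 + 2 * c * s| := by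
          rw [abs_mul, abs_mul, abs_neg, hε, one_mul, abs_of_nonneg (pow_nonneg hc0 _)]
      _ ≤ c ^ n * (|κ ^ 2| + |2 * c * s|) := by gcongr; exact abs_add_le _ _
      _ = c ^ n * (κ ^ 2 + 2 * c * |s|) := by
          rw [abs_mul, abs_of_nonneg (sq_nonneg κ), abs_of_nonneg (by linarith : 0 ≤ 2 * c)]
      _ ≤ b ^ n * (κ ^ 2 + 2 * b * N) := by gcongr
      _ = 2 * (b ^ (n + 1) * N) + b ^ n * κ ^ 2 := by ring
      _ ≤ _ := by linarith

variable {n : ℕ} {ε κ b m T : ℝ} {x y s : ℝ → ℝ}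

/-- The level `2 x s = y² - κ²` is invariant as long as the truncation is not active. -/
lemma level_eq_of_clamped (hm : m ≠ 0)
    (hx : ∀ t ∈ Icc 0 T, HasDerivWithinAt x (y t) (Icc 0 T) t)
    (hy : ∀ t ∈ Icc 0 T, HasDerivWithinAt y (s t - ε * max 0 (min b (x t)) ^ (n + 1) * y t)
      (Icc 0 T) t)
    (hs : ∀ t ∈ Icc 0 T, HasDerivWithinAt s (-ε * max 0 (min b (x t)) ^ n *
      (κ ^ 2 + 2 * max 0 (min b (x t)) * s t)) (Icc 0 T) t)
    (hx0 : x 0 = m) (hy0 : y 0 = 0) (hs0 : s 0 = -κ ^ 2 / (2 * m))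
    (hxb : ∀ t ∈ Icc 0 T, x t ∈ Icc 0 b) :
    ∀ t ∈ Icc 0 T, 2 * x t * s t = y t ^ 2 - κ ^ 2 := by
  have hc : ∀ t ∈ Icc 0 T, max 0 (min b (x t)) = x t := fun t ht ↦ by
    rw [min_eq_right (hxb t ht).2, max_eq_right (hxb t ht).1]
  have hN : ∀ t ∈ Icc 0 T, HasDerivWithinAt (fun t ↦ 2 * x t * s t - y t ^ 2 + κ ^ 2)
      (-2 * ε * x t ^ (n + 1) * (2 * x t * s t - y t ^ 2 + κ ^ 2)) (Icc 0 T) t := by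
    intro t ht
    have h1 := hy t ht
    have h2 := hs t ht
    rw [hc t ht] at h1 h2
    refine (((((hx t ht).const_mul 2).mul h2).sub (h1.pow 2)).add_const (κ ^ 2)).congr_deriv ?_
    simp only [Nat.cast_ofNat]
    ring
  have h := eq_zero_of_abs_deriv_le_mul_abs_self_of_eq_zero_right
    (f := fun t ↦ 2 * x t * s t - y t ^ 2 + κ ^ 2) (a := 0) (b := T)
    (f' := fun t ↦ -2 * ε * x t ^ (n + 1) * (2 * x t * s t - y t ^ 2 + κ ^ 2))
    (K := 2 * |ε| * b ^ (n + 1))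
    (fun t ht ↦ (hN t ht).continuousWithinAt)
    (fun t ht ↦ (hN t ⟨ht.1, ht.2.le⟩).mono_of_mem_nhdsWithin (Icc_mem_nhdsGE_of_mem ht))
    (by simp only [hx0, hy0, hs0]; field_simp; ring)
    (fun t ht ↦ by
      have h1 := hxb t ⟨ht.1, ht.2.le⟩
      rw [Real.norm_eq_abs, Real.norm_eq_abs, abs_mul, abs_mul, abs_mul,
        abs_of_nonneg (pow_nonneg h1.1 (n + 1)), abs_neg, Nat.abs_ofNat]
      gcongr
      exacts [h1.1, h1.2])
  intro t ht
  linarith [h t ht]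

/-- A solution of the truncated system is an honest descent while it stays in `x ≥ 0`. -/
lemma IsDescent.of_clamped (hκ : 0 < κ) (hm : 0 < m) (hmb : m ≤ b) (hT : 0 < T)
    (hx : ∀ t ∈ Icc 0 T, HasDerivWithinAt x (y t) (Icc 0 T) t)
    (hy : ∀ t ∈ Icc 0 T, HasDerivWithinAt y (s t - ε * max 0 (min b (x t)) ^ (n + 1) * y t)
      (Icc 0 T) t)
    (hs : ∀ t ∈ Icc 0 T, HasDerivWithinAt s (-ε * max 0 (min b (x t)) ^ n *
      (κ ^ 2 + 2 * max 0 (min b (x t)) * s t)) (Icc 0 T) t)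
    (hx0 : x 0 = m) (hy0 : y 0 = 0) (hs0 : s 0 = -κ ^ 2 / (2 * m))
    (hpos : ∀ t ∈ Icc 0 T, 0 ≤ x t) : IsDescent n ε κ m T x y s := by
  have anti : ∀ t ∈ Icc 0 T, (∀ u ∈ Icc 0 t, y u ≤ 0) → ∀ u ∈ Icc 0 t, x u ∈ Icc 0 b := by
    intro t ht h u hu
    have hsub : Icc 0 t ⊆ Icc 0 T := Icc_subset_Icc le_rfl ht.2
    have h1 := antitoneOn_Icc_of_hasDerivWithinAt (fun v hv ↦ (hx v (hsub hv)).mono hsub) h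
      ⟨le_rfl, ht.1⟩ hu hu.1
    exact ⟨hpos u (hsub hu), by linarith⟩
  have level : ∀ t ∈ Icc 0 T, (∀ u ∈ Icc 0 t, y u ≤ 0) →
      ∀ u ∈ Icc 0 t, 2 * x u * s u = y u ^ 2 - κ ^ 2 := by
    intro t ht h
    have hsub : Icc 0 t ⊆ Icc 0 T := Icc_subset_Icc le_rfl ht.2
    exact level_eq_of_clamped hm.ne' (fun v hv ↦ (hx v (hsub hv)).mono hsub)
      (fun v hv ↦ (hy v (hsub hv)).mono hsub) (fun v hv ↦ (hs v (hsub hv)).mono hsub)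
      hx0 hy0 hs0 (anti t ht h)
  have neg : ∀ t ∈ Ioc 0 T, y t < 0 := by
    have h0 : (0 : ℝ) ∈ Icc 0 T := ⟨le_rfl, hT.le⟩
    obtain ⟨c, hc, hcy⟩ := exists_forall_lt_left_of_hasDerivWithinAt_neg hT (hy 0 h0) (by
      rw [hy0, hs0, mul_zero, sub_zero]
      exact div_neg_of_neg_of_pos (by nlinarith) (by linarith))
    rw [hy0] at hcy
    have hyc : ContinuousOn y (Icc 0 T) := fun t ht ↦ (hy t ht).continuousWithinAt
    by_contra! hex
    obtain ⟨t₀, ht₀, hyt₀⟩ := hex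
    have hct₀ : c ≤ t₀ := by
      by_contra! h
      linarith [hcy t₀ ⟨ht₀.1, h⟩]
    have hK : IsCompact (Icc c T ∩ y ⁻¹' Ici 0) :=
      isCompact_Icc.of_isClosed_subset
        ((hyc.mono (Icc_subset_Icc hc.1.le le_rfl)).preimage_isClosed_of_isClosed isClosed_Icc
          isClosed_Ici) inter_subset_left
    obtain ⟨t₁, ⟨ht₁, hyt₁⟩, hmin⟩ := hK.exists_isLeast ⟨t₀, ⟨hct₀, ht₀.2⟩, hyt₀⟩
    have ht₁0 : 0 < t₁ := hc.1.trans_le ht₁.1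
    have hlt : ∀ u ∈ Ioo 0 t₁, y u < 0 := by
      intro u hu
      rcases lt_or_ge u c with h | h
      · exact hcy u ⟨hu.1, h⟩
      · by_contra! h2
        exact hu.2.not_ge (hmin ⟨⟨h, hu.2.le.trans ht₁.2⟩, h2⟩)
    have ht₁T : t₁ ∈ Icc 0 T := ⟨ht₁0.le, ht₁.2⟩
    have hsub : Icc 0 t₁ ⊆ Icc 0 T := Icc_subset_Icc le_rfl ht₁.2
    have hle : ∀ u ∈ Icc 0 t₁, y u ≤ 0 := by
      have h1 := (hyc.mono hsub).preimage_isClosed_of_isClosed isClosed_Icc (isClosed_Iic (a := 0))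
      have h2 : closure (Ioo 0 t₁) ⊆ Icc 0 t₁ ∩ y ⁻¹' Iic 0 :=
        h1.closure_subset_iff.2 fun u hu ↦ ⟨⟨hu.1.le, hu.2.le⟩, (hlt u hu).le⟩
      rw [closure_Ioo ht₁0.ne] at h2
      exact fun u hu ↦ (h2 hu).2
    have hend : t₁ ∈ Icc 0 t₁ := ⟨ht₁0.le, le_rfl⟩
    have hy1 : y t₁ = 0 := le_antisymm (hle t₁ hend) hyt₁
    have h3 := level t₁ ht₁T hle t₁ hend
    have hs1 : s t₁ < 0 := by
      by_contra! h
      rw [hy1] at h3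
      nlinarith [mul_nonneg (hpos t₁ ht₁T) h]
    obtain ⟨u, hu, hyu⟩ := exists_gt_right_of_hasDerivWithinAt_neg ht₁0
      ((hy t₁ ht₁T).mono hsub) (by rwa [hy1, mul_zero, sub_zero])
    linarith [hlt u hu]
  have hT' : T ∈ Icc 0 T := ⟨hT.le, le_rfl⟩
  have hle : ∀ u ∈ Icc 0 T, y u ≤ 0 := by
    intro t ht
    rcases ht.1.eq_or_lt with rfl | h0
    · exact hy0.le
    · exact (neg t ⟨h0, ht.2⟩).le
  have hxb := anti T hT' hle
  have inv := level T hT' hle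
  have hc : ∀ t ∈ Icc 0 T, max 0 (min b (x t)) = x t := fun t ht ↦ by
    rw [min_eq_right (hxb t ht).2, max_eq_right (hxb t ht).1]
  exact
    { pos := hT
      hx := hx
      hy := fun t ht ↦ by simpa only [hc t ht] using hy t ht
      hs := fun t ht ↦ by
        refine (hs t ht).congr_deriv ?_
        rw [hc t ht]
        linear_combination (-ε * x t ^ n) * inv t ht
      x_zero := hx0
      y_zero := hy0
      s_zero := hs0
      nonneg := hpos
      neg := neg
      inv := inv }

/-- The descent time from any height at most `b` is less than this bound. -/
noncomputable def descentTimeBound (n : ℕ) (κ b : ℝ) : ℝ :=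
  2 * b / κ + 2 * b * (κ + b ^ (n + 2)) / κ ^ 2 + 1

lemma IsDescent.lt_descentTimeBound (h : IsDescent n ε κ m T x y s) (hε : ε = 1 ∨ ε = -1)
    (hκ : 0 < κ) (hm : 0 < m) (hmb : m ≤ b) : T < descentTimeBound n κ b := by
  have hb : 0 < b := hm.trans_le hmb
  have h1 : 0 ≤ 2 * b / κ := by positivity
  have h2 : 0 ≤ 2 * b * (κ + b ^ (n + 2)) / κ ^ 2 := by positivity
  unfold descentTimeBound
  rcases hε with rfl | rfl
  · have h3 : 2 * m * (κ + m ^ (n + 2)) / κ ^ 2 ≤ 2 * b * (κ + b ^ (n + 2)) / κ ^ 2 := by gcongr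
    linarith [h.time_le hκ hm]
  · have h3 : 2 * m / κ ≤ 2 * b / κ := by gcongr
    linarith [h.time_le' hκ hm]

lemma exists_isDescent_of_clamped (hε : ε = 1 ∨ ε = -1) (hκ : 0 < κ) (hm : 0 < m) (hmb : m ≤ b)
    (hT : T = descentTimeBound n κ b)
    (hx : ∀ t ∈ Icc 0 T, HasDerivWithinAt x (y t) (Icc 0 T) t)
    (hy : ∀ t ∈ Icc 0 T, HasDerivWithinAt y (s t - ε * max 0 (min b (x t)) ^ (n + 1) * y t)
      (Icc 0 T) t)
    (hs : ∀ t ∈ Icc 0 T, HasDerivWithinAt s (-ε * max 0 (min b (x t)) ^ n *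
      (κ ^ 2 + 2 * max 0 (min b (x t)) * s t)) (Icc 0 T) t)
    (hx0 : x 0 = m) (hy0 : y 0 = 0) (hs0 : s 0 = -κ ^ 2 / (2 * m)) :
    ∃ τ ∈ Icc 0 T, x τ = 0 ∧ IsDescent n ε κ m τ x y s ∧
      ∀ t ∈ Icc 0 T, x t = 0 → (∀ u ∈ Icc 0 t, 0 ≤ x u) → t = τ := by
  have hb : 0 < b := hm.trans_le hmb
  have hT0 : 0 < T := by
    rw [hT]
    unfold descentTimeBound
    positivity
  have desc : ∀ t ∈ Ioc 0 T, (∀ u ∈ Icc 0 t, 0 ≤ x u) → IsDescent n ε κ m t x y s := by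
    intro t ht h
    have hsub : Icc 0 t ⊆ Icc 0 T := Icc_subset_Icc le_rfl ht.2
    exact .of_clamped hκ hm hmb ht.1 (fun v hv ↦ (hx v (hsub hv)).mono hsub)
      (fun v hv ↦ (hy v (hsub hv)).mono hsub) (fun v hv ↦ (hs v (hsub hv)).mono hsub)
      hx0 hy0 hs0 h
  have hxc : ContinuousOn x (Icc 0 T) := fun t ht ↦ (hx t ht).continuousWithinAt
  have hex : ∃ t ∈ Icc 0 T, x t ≤ 0 := by
    by_contra! h
    have h1 := (desc T ⟨hT0, le_rfl⟩ fun u hu ↦ (h u hu).le).lt_descentTimeBound hε hκ hm hmb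
    linarith
  obtain ⟨t₀, ht₀, hxt₀⟩ := hex
  have hK : IsCompact (Icc 0 T ∩ x ⁻¹' Iic 0) :=
    isCompact_Icc.of_isClosed_subset (hxc.preimage_isClosed_of_isClosed isClosed_Icc isClosed_Iic)
      inter_subset_left
  obtain ⟨τ, ⟨hτ, hxτ⟩, hmin⟩ := hK.exists_isLeast ⟨t₀, ht₀, hxt₀⟩
  have hlt : ∀ u ∈ Icc 0 T, u < τ → 0 < x u := fun u hu h ↦ by
    by_contra! h2
    exact h.not_ge (hmin ⟨hu, h2⟩)
  have hz : x τ = 0 := by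
    obtain ⟨u, hu, hxu⟩ : (0 : ℝ) ∈ x '' Icc 0 τ :=
      intermediate_value_Icc' hτ.1 (hxc.mono (Icc_subset_Icc le_rfl hτ.2))
        ⟨hxτ, by rw [hx0]; exact hm.le⟩
    have h1 : τ ≤ u := hmin ⟨⟨hu.1, hu.2.trans hτ.2⟩, hxu.le⟩
    rwa [le_antisymm hu.2 h1] at hxu
  have pos_of_zero : ∀ t ∈ Icc 0 T, x t = 0 → 0 < t := by
    intro t ht h
    rcases ht.1.eq_or_lt with rfl | h0
    · linarith
    · exact h0
  have hd := desc τ ⟨pos_of_zero τ hτ hz, hτ.2⟩ fun u hu ↦ by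
    rcases hu.2.eq_or_lt with rfl | h
    · exact hz.ge
    · exact (hlt u ⟨hu.1, hu.2.trans hτ.2⟩ h).le
  refine ⟨τ, hτ, hz, hd, fun t ht hxt hpos ↦ ?_⟩
  have h1 : τ ≤ t := hmin ⟨ht, hxt.le⟩
  by_contra hne
  have h2 := (desc t ⟨pos_of_zero t ht hxt, ht.2⟩ hpos).strictAntiOn ⟨hτ.1, h1⟩ ⟨ht.1, le_rfl⟩
    (lt_of_le_of_ne h1 (Ne.symm hne))
  linarith

end Clamped

section Family

/-- A uniquely determined first hitting time depends continuously on the parameter. -/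
lemma continuousOn_of_unique_hitting {X : ℝ × ℝ → ℝ} {τ : ℝ → ℝ} {a b T : ℝ}
    (hX : ContinuousOn X (Icc a b ×ˢ Icc 0 T)) (hτ : ∀ m ∈ Icc a b, τ m ∈ Icc 0 T)
    (hz : ∀ m ∈ Icc a b, X (m, τ m) = 0)
    (hpos : ∀ m ∈ Icc a b, ∀ t ∈ Icc 0 (τ m), 0 ≤ X (m, t))
    (huniq : ∀ m ∈ Icc a b, ∀ t ∈ Icc 0 T, X (m, t) = 0 → (∀ u ∈ Icc 0 t, 0 ≤ X (m, u)) →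
      t = τ m) : ContinuousOn τ (Icc a b) := by
  intro m hm
  refine tendsto_of_subseq_tendsto fun ns hns ↦ ?_
  obtain ⟨hns1, hns2⟩ := tendsto_nhdsWithin_iff.1 hns
  obtain ⟨t, ht, φ, hφ, hlim⟩ := isCompact_Icc.tendsto_subseq' (x := fun k ↦ τ (ns k))
    (hns2.mono fun k hk ↦ hτ _ hk).frequently
  refine ⟨φ, ?_⟩
  have hm1 : Tendsto (fun k ↦ ns (φ k)) atTop (𝓝 m) := hns1.comp hφ.tendsto_atTop
  have hm2 : ∀ᶠ k in atTop, ns (φ k) ∈ Icc a b := hφ.tendsto_atTop.eventually hns2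
  have key : ∀ (v : ℕ → ℝ) (u : ℝ), u ∈ Icc 0 T → Tendsto v atTop (𝓝 u) →
      (∀ᶠ k in atTop, v k ∈ Icc 0 T) →
      Tendsto (fun k ↦ X (ns (φ k), v k)) atTop (𝓝 (X (m, u))) := by
    intro v u hu hv hv2
    refine Tendsto.comp (hX (m, u) ⟨hm, hu⟩) (tendsto_nhdsWithin_iff.2 ⟨hm1.prodMk_nhds hv, ?_⟩)
    filter_upwards [hm2, hv2] with k hk hk2 using ⟨hk, hk2⟩
  have hX0 : X (m, t) = 0 := by
    refine tendsto_nhds_unique (key _ t ht hlim (hm2.mono fun k hk ↦ hτ _ hk)) ?_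
    refine tendsto_const_nhds.congr' ?_
    filter_upwards [hm2] with k hk using (hz _ hk).symm
  have hXpos : ∀ u ∈ Icc 0 t, 0 ≤ X (m, u) := by
    intro u hu
    have h1 : Tendsto (fun k ↦ min u (τ (ns (φ k)))) atTop (𝓝 u) := by
      have : Tendsto (fun k ↦ min u (τ (ns (φ k)))) atTop (𝓝 (min u t)) :=
        tendsto_const_nhds.min hlim
      rwa [min_eq_left hu.2] at this
    refine ge_of_tendsto (key _ u ⟨hu.1, hu.2.trans ht.2⟩ h1 ?_) ?_
    · filter_upwards [hm2] with k hk
      exact ⟨le_min hu.1 (hτ _ hk).1, (min_le_right _ _).trans (hτ _ hk).2⟩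
    · filter_upwards [hm2] with k hk
      exact hpos _ hk _ ⟨le_min hu.1 (hτ _ hk).1, min_le_right _ _⟩
  rw [← huniq m hm t ht hX0 hXpos]
  exact hlim

/-- The descents from all heights in `[a, b]` down to `x = 0` exist, and the value of `s` at
the bottom depends continuously on the height. -/
lemma exists_isDescent_family (n : ℕ) {ε κ a b : ℝ} (hε : ε = 1 ∨ ε = -1) (hκ : 0 < κ)
    (ha : 0 < a) (hb : 0 < b) :
    ∃ (τ : ℝ → ℝ) (x y s : ℝ → ℝ → ℝ),
      (∀ m ∈ Icc a b, x m (τ m) = 0 ∧ IsDescent n ε κ m (τ m) (x m) (y m) (s m)) ∧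
      ContinuousOn (fun m ↦ s m (τ m)) (Icc a b) := by
  set T := descentTimeBound n κ b with hT
  have hT0 : 0 ≤ T := by
    rw [hT]
    unfold descentTimeBound
    positivity
  have hr : 0 ≤ b + κ ^ 2 / (2 * a) := by positivity
  obtain ⟨α, hα, hαc⟩ := exists_flow_of_linear_growth
    (locallyLipschitz_clampedField n ε κ b) (by positivity) (by positivity)
    (norm_clampedField_le n (by rcases hε with rfl | rfl <;> simp) hb.le) hT0 hr
  let p : ℝ → ℝ × ℝ × ℝ := fun m ↦ (m, 0, -κ ^ 2 / (2 * m))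
  have hp : ∀ m ∈ Icc a b, p m ∈ Metric.closedBall 0 (b + κ ^ 2 / (2 * a)) := by
    intro m hm
    have hm0 : 0 < m := ha.trans_le hm.1
    have h1 : κ ^ 2 / (2 * m) ≤ κ ^ 2 / (2 * a) := by gcongr; exact hm.1
    have h2 : 0 ≤ κ ^ 2 / (2 * a) := by positivity
    have h3 : 0 ≤ κ ^ 2 / (2 * m) := by positivity
    rw [mem_closedBall_zero_iff]
    refine max_le ?_ (max_le ?_ ?_)
    · rw [Real.norm_eq_abs, abs_of_pos hm0]
      linarith [hm.2]
    · simpa [p] using hr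
    · have h4 : -κ ^ 2 / (2 * m) = -(κ ^ 2 / (2 * m)) := by ring
      simp only [p]
      rw [h4, Real.norm_eq_abs, abs_neg, abs_of_nonneg h3]
      linarith
  have hpc : ContinuousOn p (Icc a b) := by
    have : ∀ m ∈ Icc a b, 2 * m ≠ 0 := fun m hm ↦ by
      have := ha.trans_le hm.1
      positivity
    fun_prop (disch := assumption)
  have hd : ∀ m ∈ Icc a b, ∃ τ ∈ Icc 0 T, (α (p m, τ)).1 = 0 ∧
      IsDescent n ε κ m τ (fun t ↦ (α (p m, t)).1) (fun t ↦ (α (p m, t)).2.1)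
        (fun t ↦ (α (p m, t)).2.2) ∧
      ∀ t ∈ Icc 0 T, (α (p m, t)).1 = 0 → (∀ u ∈ Icc 0 t, 0 ≤ (α (p m, u)).1) → t = τ := by
    intro m hm
    obtain ⟨h0, hder⟩ := hα (p m) (hp m hm)
    refine exists_isDescent_of_clamped hε hκ (ha.trans_le hm.1) hm.2 hT
      (x := fun t ↦ (α (p m, t)).1) (y := fun t ↦ (α (p m, t)).2.1)
      (s := fun t ↦ (α (p m, t)).2.2)
      (fun t ht ↦ ?_) (fun t ht ↦ ?_) (fun t ht ↦ ?_) ?_ ?_ ?_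
    · exact (hasFDerivAt_fst (𝕜 := ℝ)).comp_hasDerivWithinAt t (hder t ht)
    · exact (hasFDerivAt_fst (𝕜 := ℝ)).comp_hasDerivWithinAt t
        ((hasFDerivAt_snd (𝕜 := ℝ)).comp_hasDerivWithinAt t (hder t ht))
    · exact (hasFDerivAt_snd (𝕜 := ℝ)).comp_hasDerivWithinAt t
        ((hasFDerivAt_snd (𝕜 := ℝ)).comp_hasDerivWithinAt t (hder t ht))
    all_goals simp only [h0, p]
  choose! τ hτ hz hdesc huniq using hd
  have hcont : ContinuousOn (fun z : ℝ × ℝ ↦ α (p z.1, z.2)) (Icc a b ×ˢ Icc 0 T) := by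
    refine hαc.comp ((hpc.comp continuousOn_fst fun z hz ↦ hz.1).prodMk continuousOn_snd) ?_
    exact fun z hz ↦ ⟨hp _ hz.1, hz.2⟩
  have hτc : ContinuousOn τ (Icc a b) :=
    continuousOn_of_unique_hitting (X := fun z ↦ (α (p z.1, z.2)).1)
      (continuous_fst.comp_continuousOn hcont) hτ hz (fun m hm ↦ (hdesc m hm).nonneg) huniq
  refine ⟨τ, fun m t ↦ (α (p m, t)).1, fun m t ↦ (α (p m, t)).2.1, fun m t ↦ (α (p m, t)).2.2,
    fun m hm ↦ ⟨hz m hm, hdesc m hm⟩, ?_⟩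
  exact (continuous_snd.comp continuous_snd).comp_continuousOn
    (hcont.comp (f := fun m ↦ (m, τ m)) (continuousOn_id.prodMk hτc) fun m hm ↦ ⟨hm, hτ m hm⟩)

/-- Some height `m` has descents in both time directions that reach `x = 0` with opposite
values of `s`. -/
lemma exists_matching_descents (n : ℕ) {κ : ℝ} (hκ : 0 < κ) :
    ∃ (m τ₁ τ₂ : ℝ) (x₁ y₁ s₁ x₂ y₂ s₂ : ℝ → ℝ),
      IsDescent n 1 κ m τ₁ x₁ y₁ s₁ ∧ IsDescent n (-1) κ m τ₂ x₂ y₂ s₂ ∧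
      x₁ τ₁ = 0 ∧ x₂ τ₂ = 0 ∧ s₁ τ₁ = -s₂ τ₂ := by
  set a := min 1 (κ / 4) with ha_def
  set b := ((n : ℝ) + 1) * (n + 2) * (κ + 1) + 1 with hb_def
  have ha : 0 < a := lt_min one_pos (by linarith)
  have hb1 : 1 ≤ b := by
    have : 0 ≤ ((n : ℝ) + 1) * (n + 2) * (κ + 1) := by positivity
    linarith
  have hb : 0 < b := by linarith
  have hab : a ≤ b := (min_le_left _ _).trans hb1
  obtain ⟨τ₁, x₁, y₁, s₁, h₁, hc₁⟩ :=
    exists_isDescent_family n (ε := 1) (a := a) (b := b) (.inl rfl) hκ ha hb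
  obtain ⟨τ₂, x₂, y₂, s₂, h₂, hc₂⟩ :=
    exists_isDescent_family n (ε := -1) (a := a) (b := b) (.inr rfl) hκ ha hb
  have ha_mem : a ∈ Icc a b := ⟨le_rfl, hab⟩
  have hb_mem : b ∈ Icc a b := ⟨hab, le_rfl⟩
  have hlow : s₁ a (τ₁ a) + s₂ a (τ₂ a) ≤ 0 := by
    have h3 := (h₁ a ha_mem).2.s_nonpos ha (h₁ a ha_mem).2.end_mem
    have h4 := (h₂ a ha_mem).2.s_end_nonpos hκ ha (min_le_left _ _) (min_le_right _ _)
    linarith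
  have hhigh : 0 ≤ s₁ b (τ₁ b) + s₂ b (τ₂ b) := by
    have h3 := (h₁ b hb_mem).2.le_s_end hκ hb1 (h₁ b hb_mem).1
    have h4 := (h₂ b hb_mem).2.le_s_end' hκ hb (h₂ b hb_mem).1
    have h5 : κ ^ 2 / (2 * b) ≤ κ ^ 2 / 2 := by
      gcongr
      linarith
    have h6 : κ * (κ + 1) ≤ κ * b ^ (n + 1) / (((n : ℝ) + 1) * (n + 2)) := by
      rw [le_div_iff₀ (by positivity)]
      have h7 : b ≤ b ^ (n + 1) := le_self_pow₀ hb1 (by omega)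
      have h8 : κ * (((n : ℝ) + 1) * (n + 2) * (κ + 1)) ≤ κ * b ^ (n + 1) := by
        gcongr
        linarith
      linarith
    have h9 : -κ ^ 2 / (2 * b) = -(κ ^ 2 / (2 * b)) := by ring
    have h10 : -κ ^ 2 / 2 = -(κ ^ 2 / 2) := by ring
    nlinarith
  obtain ⟨m, hm, hsum⟩ := intermediate_value_Icc hab (hc₁.add hc₂) ⟨hlow, hhigh⟩
  exact ⟨m, τ₁ m, τ₂ m, x₁ m, y₁ m, s₁ m, x₂ m, y₂ m, s₂ m, (h₁ m hm).2, (h₂ m hm).2,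
    (h₁ m hm).1, (h₂ m hm).1, by simp only [Pi.add_apply] at hsum; linarith⟩

end Family

section Arch

lemma HasDerivWithinAt.comp_neg_Icc {f : ℝ → ℝ} {d τ t : ℝ}
    (h : HasDerivWithinAt f d (Icc 0 τ) (-t)) :
    HasDerivWithinAt (fun u ↦ f (-u)) (-d) (Icc (-τ) 0) t := by
  have hm : MapsTo (fun u : ℝ ↦ -u) (Icc (-τ) 0) (Icc 0 τ) :=
    fun u hu ↦ ⟨by linarith [hu.2], by linarith [hu.1]⟩
  simpa [Function.comp_def] using! h.comp t (hasDerivWithinAt_neg t _) hm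

lemma hasDerivWithinAt_ite {f₁ f₂ g₁ g₂ : ℝ → ℝ} {a c b : ℝ} (hac : a < c) (hcb : c < b)
    (h₁ : ∀ t ∈ Icc a c, HasDerivWithinAt f₁ (g₁ t) (Icc a c) t)
    (h₂ : ∀ t ∈ Icc c b, HasDerivWithinAt f₂ (g₂ t) (Icc c b) t)
    (hf : f₁ c = f₂ c) (hg : g₁ c = g₂ c) :
    ∀ t ∈ Icc a b, HasDerivWithinAt (fun t ↦ if t ≤ c then f₁ t else f₂ t)
      (if t ≤ c then g₁ t else g₂ t) (Icc a b) t := by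
  have h2 : ∀ {k₁ k₂ : ℝ → ℝ}, k₁ c = k₂ c → ∀ t ∈ Icc c b,
      (if t ≤ c then k₁ t else k₂ t) = k₂ t := by
    intro k₁ k₂ hk t ht
    split_ifs with h
    · rw [le_antisymm h ht.1, hk]
    · rfl
  refine HasDerivWithinAt.union_Icc hac hcb (fun t ht ↦ ?_) (fun t ht ↦ ?_)
  · rw [if_pos ht.2]
    exact (h₁ t ht).congr_of_mem (fun u hu ↦ if_pos hu.2) ht
  · rw [h2 hg t ht]
    exact (h₂ t ht).congr_of_mem (fun u hu ↦ h2 hf u hu) ht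

/-- The half of the periodic orbit in `x ≥ 0`, parametrized by `[A, A + P]`. -/
structure IsArch (n : ℕ) (κ A P : ℝ) (x y s : ℝ → ℝ) : Prop where
  pos : 0 < P
  hx : ∀ t ∈ Icc A (A + P), HasDerivWithinAt x (y t) (Icc A (A + P)) t
  hy : ∀ t ∈ Icc A (A + P), HasDerivWithinAt y (s t - x t ^ (n + 1) * y t) (Icc A (A + P)) t
  hs : ∀ t ∈ Icc A (A + P), HasDerivWithinAt s (-(x t ^ n * y t ^ 2)) (Icc A (A + P)) t
  x_left : x A = 0
  x_right : x (A + P) = 0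
  y_left : y A = κ
  y_right : y (A + P) = -κ
  s_right : s (A + P) = -s A
  x_pos : ∀ t ∈ Ioo A (A + P), 0 < x t
  inv : ∀ t ∈ Icc A (A + P), 2 * x t * s t = y t ^ 2 - κ ^ 2

lemma IsDescent.pos_of_lt {n : ℕ} {ε κ m τ : ℝ} {x y s : ℝ → ℝ}
    (h : IsDescent n ε κ m τ x y s) {t : ℝ} (h0 : 0 ≤ t) (ht : t < τ) : 0 < x t :=
  (h.nonneg τ h.end_mem).trans_lt (h.strictAntiOn ⟨h0, ht.le⟩ h.end_mem ht)

lemma exists_isArch (n : ℕ) {κ : ℝ} (hκ : 0 < κ) :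
    ∃ (A P : ℝ) (x y s : ℝ → ℝ), IsArch n κ A P x y s := by
  obtain ⟨m, τ₁, τ₂, x₁, y₁, s₁, x₂, y₂, s₂, h₁, h₂, hz₁, hz₂, hs⟩ :=
    exists_matching_descents n hκ
  have hτ₁ := h₁.pos
  have hτ₂ := h₂.pos
  have neg_mem : ∀ t ∈ Icc (-τ₂) 0, -t ∈ Icc 0 τ₂ := fun t ht ↦
    ⟨by linarith [ht.2], by linarith [ht.1]⟩
  have hend : -τ₂ + (τ₂ + τ₁) = τ₁ := by ring
  refine ⟨-τ₂, τ₂ + τ₁, fun t ↦ if t ≤ 0 then x₂ (-t) else x₁ t,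
    fun t ↦ if t ≤ 0 then -y₂ (-t) else y₁ t, fun t ↦ if t ≤ 0 then s₂ (-t) else s₁ t, ?_⟩
  have hneg : -τ₂ ≤ 0 := by linarith
  constructor
  case pos => linarith
  case hx =>
    rw [hend]
    refine hasDerivWithinAt_ite (by linarith) hτ₁
      (fun t ht ↦ (h₂.hx _ (neg_mem t ht)).comp_neg_Icc) h₁.hx ?_ ?_
    · rw [neg_zero, h₁.x_zero, h₂.x_zero]
    · rw [neg_zero, h₁.y_zero, h₂.y_zero, neg_zero]
  case hy =>
    rw [hend]
    intro t ht
    refine (hasDerivWithinAt_ite (by linarith) hτ₁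
      (fun t ht ↦ (h₂.hy _ (neg_mem t ht)).comp_neg_Icc.fun_neg) h₁.hy ?_ ?_ t ht).congr_deriv ?_
    · rw [neg_zero, h₁.y_zero, h₂.y_zero, neg_zero]
    · rw [neg_zero, h₁.y_zero, h₂.y_zero, h₁.s_zero, h₂.s_zero]
      ring
    · split_ifs <;> ring
  case hs =>
    rw [hend]
    intro t ht
    refine (hasDerivWithinAt_ite (by linarith) hτ₁
      (fun t ht ↦ (h₂.hs _ (neg_mem t ht)).comp_neg_Icc) h₁.hs ?_ ?_ t ht).congr_deriv ?_
    · rw [neg_zero, h₁.s_zero, h₂.s_zero]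
    · rw [neg_zero, h₁.y_zero, h₂.y_zero]
      ring
    · split_ifs <;> ring
  case x_left => simp only [if_pos hneg, neg_neg, hz₂]
  case x_right => simp only [hend, if_neg hτ₁.not_ge, hz₁]
  case y_left => simp only [if_pos hneg, neg_neg, h₂.y_end hκ hz₂]
  case y_right => simp only [hend, if_neg hτ₁.not_ge, h₁.y_end hκ hz₁]
  case s_right => simp only [hend, if_neg hτ₁.not_ge, if_pos hneg, neg_neg, hs]
  case x_pos =>
    rw [hend]
    intro t ht
    split_ifs with h
    · exact h₂.pos_of_lt (by linarith) (by linarith [ht.1])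
    · exact h₁.pos_of_lt (by linarith) ht.2
  case inv =>
    rw [hend]
    intro t ht
    split_ifs with h
    · rw [h₂.inv _ (neg_mem t ⟨ht.1, h⟩)]
      ring
    · exact h₁.inv t ⟨by linarith, ht.2⟩

end Arch

section Orbit

/-- Arches extend antiperiodically to solutions of the Chazy system on the whole line. -/
lemma IsArch.exists_extension {n : ℕ} {κ A P : ℝ} {x y s : ℝ → ℝ} (h : IsArch n κ A P x y s) :
    ∃ X Y S : ℝ → ℝ, Function.Antiperiodic X P ∧ Y A = κ ∧ Continuous S ∧
      (∀ t, HasDerivAt X (Y t) t) ∧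
      (∀ t, HasDerivAt Y (S t - |X t| ^ (n + 1) * Y t) t) ∧
      (∀ t, X t ≠ 0 → HasDerivAt S (-(|X t| ^ (n + 1) / X t * Y t ^ 2)) t) ∧
      (∀ t, 2 * X t * S t = Y t ^ 2 - κ ^ 2) := by
  have hP := h.pos
  obtain ⟨X, hXP, hX⟩ := exists_antiperiodic_extension (f := x) (A := A) hP
    (by rw [h.x_left, h.x_right, neg_zero])
  obtain ⟨Y, hYP, hY⟩ := exists_antiperiodic_extension (f := y) (A := A) hP
    (by rw [h.y_left, h.y_right])
  obtain ⟨S, hSP, hS⟩ := exists_antiperiodic_extension (f := s) (A := A) hP h.s_right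
  have hA : A ∈ Icc A (A + P) := ⟨le_rfl, by linarith⟩
  have nonneg : ∀ t ∈ Icc A (A + P), 0 ≤ x t := by
    intro t ht
    rcases ht.1.eq_or_lt with rfl | h1
    · exact h.x_left.ge
    rcases ht.2.eq_or_lt with rfl | h2
    · exact h.x_right.ge
    · exact (h.x_pos t ⟨h1, h2⟩).le
  refine ⟨X, Y, S, hXP, by rw [hY hA, h.y_left], ?_, ?_, ?_, ?_, ?_⟩
  · refine continuous_of_antiperiodic (A := A) hP hSP (ContinuousOn.congr ?_ hS)
    exact fun t ht ↦ (h.hs t ht).continuousWithinAt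
  · refine hasDerivAt_of_antiperiodic (A := A) hP hXP hYP fun t ht ↦ ?_
    rw [hY ht]
    exact (h.hx t ht).congr_of_mem hX ht
  · refine hasDerivAt_of_antiperiodic (G := fun t ↦ S t - |X t| ^ (n + 1) * Y t) (A := A) hP hYP
      (fun t ↦ ?_) fun t ht ↦ ?_
    · simp only [hXP t, hYP t, hSP t, abs_neg]
      ring
    · rw [hX ht, hY ht, hS ht, abs_of_nonneg (nonneg t ht)]
      exact (h.hy t ht).congr_of_mem hY ht
  · have per : Function.Periodic
        (fun t ↦ X t ≠ 0 → HasDerivAt S (-(|X t| ^ (n + 1) / X t * Y t ^ 2)) t) P := by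
      intro t
      simp only [eq_iff_iff, hXP t, hYP t, abs_neg, neg_ne_zero, div_neg, neg_mul, even_two,
        Even.neg_pow]
      refine imp_congr_right fun _ ↦ ⟨fun h ↦ ?_, fun h ↦ ?_⟩
      · have h6 := (h.comp_add_const t P).neg
        simpa only [Pi.neg_def, hSP _, neg_neg] using h6
      · have h6 : HasDerivAt S (-(|X t| ^ (n + 1) / X t * Y t ^ 2)) (t + P + -P) := by
          simpa using h
        have h7 := (h6.comp_add_const (t + P) (-P)).neg
        simpa only [← sub_eq_add_neg, Pi.neg_def, hSP.neg_sub_eq] using h7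
    intro t
    obtain ⟨u, hu, hu2⟩ := per.exists_mem_Ioc hP t A
    refine hu2.mpr fun hne ↦ ?_
    have hu' : u ∈ Icc A (A + P) := ⟨hu.1.le, hu.2⟩
    have hlt : u < A + P := by
      refine hu.2.lt_of_ne fun heq ↦ hne ?_
      rw [hX hu', heq, h.x_right]
    have hpos := h.x_pos u ⟨hu.1, hlt⟩
    have hmem : Icc A (A + P) ∈ 𝓝 u := Icc_mem_nhds hu.1 hlt
    have h6 := ((h.hs u hu').hasDerivAt hmem).congr_of_eventuallyEq
      (hS.eventuallyEq_of_mem hmem)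
    refine h6.congr_deriv ?_
    rw [hX hu', hY hu', abs_of_pos hpos]
    field_simp
    ring
  · have per : Function.Periodic (fun t ↦ 2 * X t * S t = Y t ^ 2 - κ ^ 2) P := by
      intro t
      simp only [hXP t, hYP t, hSP t]
      ring_nf
    intro t
    obtain ⟨u, hu, hu2⟩ := per.exists_mem_Ioc hP t A
    refine hu2.mpr ?_
    have hu' : u ∈ Icc A (A + P) := ⟨hu.1.le, hu.2⟩
    rw [hX hu', hY hu', hS hu']
    exact h.inv u hu'

lemma hasDerivAt_abs_pow_succ (n : ℕ) {z : ℝ} (hz : z ≠ 0) :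
    HasDerivAt (fun u : ℝ ↦ |u| ^ (n + 1)) ((n + 1) * (|z| ^ (n + 1) / z)) z := by
  refine ((hasDerivAt_abs hz).pow (n + 1)).congr_deriv ?_
  rcases hz.lt_or_gt with h | h
  · rw [abs_of_neg h, sign_neg h]
    simp only [SignType.coe_neg_one]
    push_cast
    field_simp
    ring
  · rw [abs_of_pos h, sign_pos h]
    simp only [SignType.coe_one]
    push_cast
    field_simp
    ring

end Orbit

/-- Theorem 1.2: under the conditions C1, C2, C3 on the polynomials `P₀`, `P⁺`, `P⁻`,
the generalized Chazy equation with `k = q + 1` has, on each negative energy level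
`H = -ω²`, a nonconstant periodic solution. -/
theorem chazy_general_periodic_orbits (q : ℕ) (hq : 1 ≤ q)
    (hC1 : ∀ u ∈ Set.Ioo (2 : ℝ) ((1 + 4 * (q : ℝ)) / (2 * (q : ℝ))),
      (chazyP0 q).eval u ≠ 0)
    (hC2 : (((chazyPplus q).roots).filter
      (fun u => 0 < u ∧ u < chazyUiD q)).card ≤ 1)
    (hC3 : (((chazyPminus q).roots).filter
      (fun u => -2 < u ∧ u < 0)).card ≤ 1) :
    ∀ ω : ℝ, 0 < ω →
      ∃ (T : ℝ) (x : ℝ → ℝ),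
        0 < T ∧
        Function.Periodic x T ∧
        (¬ ∃ c : ℝ, ∀ t : ℝ, x t = c) ∧
        ContDiff ℝ 2 x ∧
        (∀ t : ℝ, x t ≠ 0 →
          DifferentiableAt ℝ (deriv (deriv x)) t ∧
          deriv (deriv (deriv x)) t + |x t| ^ q * deriv (deriv x) t
            + ((q : ℝ) + 1) * (|x t| ^ q / x t) * (deriv x t) ^ 2 = 0) ∧
        (∀ t : ℝ, x t * deriv (deriv x) t - (deriv x t) ^ 2 / 2
            + |x t| ^ q * x t * deriv x t = -ω ^ 2) := by
  intro ω hω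
  obtain ⟨n, rfl⟩ : ∃ n, q = n + 1 := ⟨q - 1, by omega⟩
  have hκ : 0 < √2 * ω := by positivity
  obtain ⟨A, P, x, y, s, h⟩ := exists_isArch n hκ
  obtain ⟨X, Y, S, hXP, hYA, hSc, hX, hY, hS, hinv⟩ := h.exists_extension
  have hdX : deriv X = Y := funext fun t ↦ (hX t).deriv
  have hdY : deriv Y = fun t ↦ S t - |X t| ^ (n + 1) * Y t := funext fun t ↦ (hY t).deriv
  have hXd : Differentiable ℝ X := fun t ↦ (hX t).differentiableAt
  have hYd : Differentiable ℝ Y := fun t ↦ (hY t).differentiableAt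
  refine ⟨2 * P, X, by linarith [h.pos], hXP.periodic_two_mul, ?_, ?_, ?_, ?_⟩
  · rintro ⟨c, hc⟩
    have h1 : Y = fun _ ↦ 0 := by
      rw [← hdX, show X = fun _ ↦ c from funext hc]
      simp
    rw [h1] at hYA
    exact hκ.ne hYA
  · rw [show (2 : WithTop ℕ∞) = 1 + 1 by norm_num, contDiff_succ_iff_deriv]
    refine ⟨hXd, by simp, ?_⟩
    rw [hdX, contDiff_one_iff_deriv, hdY]
    refine ⟨hYd, ?_⟩
    have := hXd.continuous
    have := hYd.continuous
    fun_prop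
  · intro t ht
    have h3 := (hS t ht).sub (((hasDerivAt_abs_pow_succ n ht).comp t (hX t)).mul (hY t))
    have h4 : deriv (deriv X) = S - (fun u ↦ |u| ^ (n + 1)) ∘ X * Y := by
      rw [hdX, hdY]
      rfl
    rw [← h4] at h3
    refine ⟨h3.differentiableAt, ?_⟩
    rw [h3.deriv, hdX, hdY]
    simp only [Function.comp_apply]
    push_cast
    ring
  · intro t
    rw [hdX, hdY]
    have h5 := hinv t
    rw [mul_pow, Real.sq_sqrt zero_le_two] at h5
    linear_combination h5 / 2
end

section
/- For every integer q with 1 ≤ q ≤ 100 and every real ω > 0, there exist T > 0 and a nonconstant T-periodic function x : ℝ → ℝ of class C² such that at every t with x(t) ≠ 0 the second derivative x'' is differentiable at t and x'''(t) + |x(t)|^q x''(t) + (q+1)(|x(t)|^q/x(t)) x'(t)² = 0, and x(t)x''(t) − x'(t)²/2 + |x(t)|^q x(t) x'(t) = −ω² for all t. (For k = q + 1 and 1 ≤ q ≤ 100 the generalized Chazy differential equation has an invariant cylinder foliated by periodic orbits.) -/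
section

open Set Filter Topology NNReal

theorem exists_solution_of_bounded_lipschitz {h : ℝ → ℝ → ℝ} {b : ℝ} (hb : 0 ≤ b) {K L : ℝ≥0}
    (hLip : ∀ t ∈ Icc 0 b, LipschitzWith K (h t))
    (hcont : ∀ z, ContinuousOn (fun t => h t z) (Icc 0 b))
    (hbd : ∀ t ∈ Icc 0 b, ∀ z, |h t z| ≤ L) (c : ℝ) :
    ∃ z : ℝ → ℝ, z 0 = c ∧ ∀ t ∈ Icc 0 b, HasDerivWithinAt z (h t (z t)) (Icc 0 b) t := by
  have hPL : IsPicardLindelof h (⟨0, left_mem_Icc.2 hb⟩ : Icc 0 b) c (L * b.toNNReal) 0 L K :=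
    { lipschitzOnWith := fun t ht => (hLip t ht).lipschitzOnWith
      continuousOn := fun x _ => hcont x
      norm_le := fun t ht x _ => hbd t ht x
      mul_max_le := by simp [hb] }
  exact hPL.exists_eq_forall_mem_Icc_hasDerivWithinAt₀

/-- Two solutions of `z' = h t z` with `h t` antitone approach each other. -/
theorem antitoneOn_sq_sub_of_antitone {h : ℝ → ℝ → ℝ} {b : ℝ}
    (hanti : ∀ t ∈ Icc 0 b, Antitone (h t)) {y z : ℝ → ℝ}
    (hy : ∀ t ∈ Icc 0 b, HasDerivWithinAt y (h t (y t)) (Icc 0 b) t)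
    (hz : ∀ t ∈ Icc 0 b, HasDerivWithinAt z (h t (z t)) (Icc 0 b) t) :
    AntitoneOn (fun t => (y t - z t) ^ 2) (Icc 0 b) := by
  have hd : ∀ t ∈ Icc 0 b, HasDerivWithinAt (fun t => (y t - z t) ^ 2)
      (2 * (y t - z t) * (h t (y t) - h t (z t))) (Icc 0 b) t := fun t ht => by
    simpa using ((hy t ht).fun_sub (hz t ht)).fun_pow 2
  apply antitoneOn_of_hasDerivWithinAt_nonpos (convex_Icc 0 b)
    (fun t ht => (hd t ht).continuousWithinAt)
    (fun t ht => (hd t (interior_subset ht)).mono interior_subset)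
  intro t ht
  rcases le_total (y t) (z t) with hle | hle
  · have := hanti t (interior_subset ht) hle
    nlinarith
  · have := hanti t (interior_subset ht) hle
    nlinarith

/-- The equation `z' = h t z` with `h` nonnegative and antitone in `z` has a solution on `[0, b]`
with opposite boundary values. -/
theorem exists_solution_endpoint_eq_neg {h : ℝ → ℝ → ℝ} {b : ℝ} (hb : 0 ≤ b) {K L : ℝ≥0}
    (hLip : ∀ t ∈ Icc 0 b, LipschitzWith K (h t))
    (hcont : ∀ z, ContinuousOn (fun t => h t z) (Icc 0 b))
    (hbd : ∀ t ∈ Icc 0 b, ∀ z, |h t z| ≤ L)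
    (hanti : ∀ t ∈ Icc 0 b, Antitone (h t)) (hnonneg : ∀ t ∈ Icc 0 b, ∀ z, 0 ≤ h t z)
    {B : ℝ} (hB : 0 ≤ B) (hhB : ∀ t ∈ Icc 0 b, h t 1 ≤ B) :
    ∃ z : ℝ → ℝ, z b = -z 0 ∧ (∀ t ∈ Icc 0 b, -(B * b + 1) ≤ z t) ∧
      ∀ t ∈ Icc 0 b, HasDerivWithinAt z (h t (z t)) (Icc 0 b) t := by
  choose Z hZ0 hZ using exists_solution_of_bounded_lipschitz hb hLip hcont hbd
  have h0 : (0 : ℝ) ∈ Icc 0 b := left_mem_Icc.2 hb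
  have h1 : b ∈ Icc 0 b := right_mem_Icc.2 hb
  have hZc : ∀ c, ContinuousOn (Z c) (Icc 0 b) := fun c t ht => (hZ c t ht).continuousWithinAt
  have hmono : ∀ c, MonotoneOn (Z c) (Icc 0 b) := fun c =>
    monotoneOn_of_hasDerivWithinAt_nonneg (convex_Icc 0 b) (hZc c)
      (fun t ht => (hZ c t (interior_subset ht)).mono interior_subset)
      (fun t ht => hnonneg t (interior_subset ht) _)
  have hge : ∀ c, ∀ t ∈ Icc 0 b, c ≤ Z c t := fun c t ht => by
    simpa [hZ0] using hmono c h0 ht ht.1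
  have hcontr : ∀ c d, (Z c b - Z d b) ^ 2 ≤ (c - d) ^ 2 := fun c d => by
    simpa [hZ0] using antitoneOn_sq_sub_of_antitone hanti (hZ c) (hZ d) h0 h1 hb
  have hcontZ : Continuous fun c => Z c b :=
    (LipschitzWith.of_dist_le_mul (K := 1) fun c d => by
      simpa [Real.dist_eq] using sq_le_sq.1 (hcontr c d)).continuous
  have hup : Z 1 b ≤ 1 + B * b := by
    have := (convex_Icc 0 b).image_sub_le_mul_sub_of_deriv_le (hZc 1)
      (fun t ht => ((hZ 1 t (interior_subset ht)).mono interior_subset).differentiableWithinAt)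
      (C := B) (fun t ht => by
        have ht' : t ∈ Ioo 0 b := by simpa using ht
        rw [((hZ 1 t (interior_subset ht)).hasDerivAt (Icc_mem_nhds ht'.1 ht'.2)).deriv]
        exact (hanti t (interior_subset ht) (hge 1 t (interior_subset ht))).trans
          (hhB t (interior_subset ht))) 0 h0 b h1 hb
    rw [hZ0] at this
    linarith
  have hcomp : ∀ c ≤ 1, Z c b ≤ Z 1 b := by
    intro c hc
    by_contra! hlt
    obtain ⟨s, hs, hs0⟩ : ∃ s ∈ Icc 0 b, Z c s - Z 1 s = 0 :=
      intermediate_value_Icc hb ((hZc c).sub (hZc 1))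
        (show (0 : ℝ) ∈ Icc (Z c 0 - Z 1 0) (Z c b - Z 1 b) by
          rw [hZ0, hZ0]; constructor <;> linarith)
    have := antitoneOn_sq_sub_of_antitone hanti (hZ c) (hZ 1) hs h1 hs.2
    simp only [hs0] at this
    nlinarith
  have hBb : 0 ≤ B * b := mul_nonneg hB hb
  obtain ⟨c, hc, hc0⟩ : ∃ c ∈ Icc (-(B * b + 1)) 1, Z c b + c = 0 :=
    intermediate_value_Icc (by linarith) (by fun_prop)
      (show (0 : ℝ) ∈ Icc (Z (-(B * b + 1)) b + -(B * b + 1)) (Z 1 b + 1) by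
        have := hcomp (-(B * b + 1)) (by linarith)
        have := hge 1 b h1
        constructor <;> linarith)
  exact ⟨Z c, by rw [hZ0]; linarith, fun t ht => hc.1.trans (hge c t ht), hZ c⟩

theorem exists_inverse_hasDerivAt {f f' : ℝ → ℝ} {a b : ℝ} (hab : a < b)
    (hf : ContinuousOn f (Icc a b)) (hf' : ∀ x ∈ Ioo a b, HasDerivAt f (f' x) x)
    (hpos : ∀ x ∈ Ioo a b, 0 < f' x) :
    f a < f b ∧ ∃ g : ℝ → ℝ, Continuous g ∧ g (f a) = a ∧ g (f b) = b ∧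
      ∀ t ∈ Ioo (f a) (f b), g t ∈ Ioo a b ∧ HasDerivAt g (f' (g t))⁻¹ t := by
  have hmono : StrictMonoOn f (Icc a b) :=
    strictMonoOn_of_deriv_pos (convex_Icc a b) hf fun x hx => by
      rw [interior_Icc] at hx
      rw [(hf' x hx).deriv]
      exact hpos x hx
  have ha : a ∈ Icc a b := left_mem_Icc.2 hab.le
  have hb : b ∈ Icc a b := right_mem_Icc.2 hab.le
  have hlt : f a < f b := hmono ha hb hab
  have hmaps : MapsTo f (Icc a b) (Icc (f a) (f b)) := fun x hx =>
    ⟨hmono.monotoneOn ha hx hx.1, hmono.monotoneOn hx hb hx.2⟩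
  have hsurj : SurjOn f (Icc a b) (Icc (f a) (f b)) := intermediate_value_Icc hab.le hf
  let e : Icc a b ≃o Icc (f a) (f b) := StrictMono.orderIsoOfSurjective
    (hmaps.restrict f _ _) (fun x y hxy => hmono x.2 y.2 hxy)
    ((MapsTo.restrict_surjective_iff hmaps).2 hsurj)
  let g : ℝ → ℝ := IccExtend hlt.le fun t => (e.symm t : ℝ)
  have hg : Continuous g := (continuous_subtype_val.comp e.symm.continuous).Icc_extend'
  have hgf : ∀ x ∈ Icc a b, g (f x) = x := fun x hx => by
    have : (⟨f x, hmaps hx⟩ : Icc (f a) (f b)) = e ⟨x, hx⟩ := rfl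
    simp only [g]
    rw [IccExtend_of_mem _ _ (hmaps hx), this, e.symm_apply_apply]
  have hfg : ∀ t ∈ Icc (f a) (f b), f (g t) = t := fun t ht => by
    obtain ⟨x, hx, rfl⟩ := hsurj ht
    rw [hgf x hx]
  refine ⟨hlt, g, hg, hgf a ha, hgf b hb, fun t ht => ?_⟩
  have hgt : g t ∈ Ioo a b := by
    obtain ⟨x, hx, rfl⟩ := hsurj (Ioo_subset_Icc_self ht)
    rw [hgf x hx]
    exact ⟨(hmono.lt_iff_lt ha hx).1 ht.1, (hmono.lt_iff_lt hx hb).1 ht.2⟩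
  exact ⟨hgt, HasDerivAt.of_local_left_inverse hg.continuousAt (hf' _ hgt) (hpos _ hgt).ne'
    (eventually_of_mem (Icc_mem_nhds ht.1 ht.2) hfg)⟩

theorem exists_continuous_antiperiodic_eqOn {f : ℝ → ℝ} {L : ℝ} (hL : 0 < L)
    (hf : ContinuousOn f (Icc 0 L)) (hfL : f L = -f 0) :
    ∃ F : ℝ → ℝ, Function.Antiperiodic F L ∧ Continuous F ∧ EqOn F f (Icc 0 L) := by
  let F : ℝ → ℝ := fun t => (-1) ^ toIcoDiv hL 0 t * f (toIcoMod hL 0 t)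
  have hF : Function.Antiperiodic F L := fun t => by
    simp [F, toIcoDiv_add_right, toIcoMod_add_right, zpow_add_one₀]
  have hIco : ∀ t ∈ Ico 0 L, F t = f t := fun t ht => by
    have ht' : t ∈ Ico 0 (0 + L) := by simpa using ht
    have h1 : toIcoMod hL 0 t = t := (toIcoMod_eq_self hL).2 ht'
    have h2 : toIcoDiv hL 0 t = 0 := toIcoDiv_eq_of_sub_zsmul_mem_Ico hL (by simpa using ht)
    simp [F, h1, h2]
  have heq : EqOn F f (Icc 0 L) := fun t ht => by
    rcases ht.2.lt_or_eq with h | rfl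
    · exact hIco t ⟨ht.1, h⟩
    · have := hF 0
      rw [zero_add, hIco 0 ⟨le_rfl, hL⟩] at this
      rw [this, hfL]
  have hright : ContinuousOn F (Icc 0 L) := hf.congr heq
  have hleft : ContinuousOn F (Icc (-L) 0) := by
    have : ContinuousOn (fun t => -F (t + L)) (Icc (-L) 0) :=
      (hright.comp (by fun_prop) fun t ht => ⟨by linarith [ht.1], by linarith [ht.2]⟩).neg
    exact this.congr fun t _ => by simp [hF t]
  have hmid : ContinuousOn F (Icc (-L) L) := by
    rw [← Icc_union_Icc_eq_Icc (neg_nonpos.2 hL.le) hL.le]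
    exact hleft.union_of_isClosed hright isClosed_Icc isClosed_Icc
  have hper : Function.Periodic (fun t => ContinuousAt F t) L := fun t => by
    have h1 : F ∘ (· + L) = -F := funext hF
    have h2 := (Homeomorph.addRight L).comp_continuousAt_iff' F t
    simp only [Homeomorph.coe_addRight] at h2
    rw [h1] at h2
    exact propext (h2.symm.trans ⟨fun h => by simpa using h.neg, fun h => h.neg⟩)
  refine ⟨F, hF, continuous_iff_continuousAt.2 fun t => ?_, heq⟩
  obtain ⟨s, hs, hts⟩ := hper.exists_mem_Ico₀ hL t
  exact hts.mpr (hmid.continuousAt (Icc_mem_nhds (by linarith [hs.1]) hs.2))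

theorem hasDerivAt_add_iff_of_antiperiodic {F G : ℝ → ℝ} {L : ℝ}
    (hF : Function.Antiperiodic F L) (hG : Function.Antiperiodic G L) (t : ℝ) :
    HasDerivAt F (G (t + L)) (t + L) ↔ HasDerivAt F (G t) t := by
  have h1 : (fun s => -F (s + L)) = F := funext fun s => by simp [hF s]
  have h2 : (fun s => -F (s - L)) = F := funext fun s => by simp [hF.sub_eq s]
  rw [hG t]
  constructor <;> intro h
  · simpa [h1] using (h.comp_add_const t L).fun_neg
  · rw [← add_sub_cancel_right t L] at h
    simpa [h2] using (h.comp_sub_const (t + L) L).fun_neg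

theorem hasDerivAt_of_antiperiodic_s4 {F G : ℝ → ℝ} {L : ℝ} (hL : 0 < L)
    (hF : Function.Antiperiodic F L) (hG : Function.Antiperiodic G L)
    (hFc : Continuous F) (hGc : Continuous G)
    (hd : ∀ t ∈ Ioo 0 L, HasDerivAt F (G t) t) (t : ℝ) : HasDerivAt F (G t) t := by
  have hper : Function.Periodic (fun t => HasDerivAt F (G t) t) L := fun t =>
    propext (hasDerivAt_add_iff_of_antiperiodic hF hG t)
  have hd' : ∀ t ∈ Ioo (-L) 0, HasDerivAt F (G t) t := fun t ht =>
    (hper t).mp (hd (t + L) ⟨by linarith [ht.1], by linarith [ht.2]⟩)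
  have hlim : ∀ {s u : Set ℝ}, s ∈ 𝓝[u] (0 : ℝ) → (∀ t ∈ s, HasDerivAt F (G t) t) →
      Tendsto (deriv F) (𝓝[u] 0) (𝓝 (G 0)) := fun hs h =>
    (hGc.continuousAt.tendsto.mono_left nhdsWithin_le_nhds).congr'
      (eventually_of_mem hs fun t ht => (h t ht).deriv.symm)
  have h0 : HasDerivAt F (G 0) 0 := by
    have hr : Ioo 0 L ∈ 𝓝[>] (0 : ℝ) := Ioo_mem_nhdsGT hL
    have hl : Ioo (-L) 0 ∈ 𝓝[<] (0 : ℝ) := Ioo_mem_nhdsLT (neg_neg_iff_pos.2 hL)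
    have h1 : HasDerivWithinAt F (G 0) (Ici 0) 0 := hasDerivWithinAt_Ici_of_tendsto_deriv
      (fun t ht => (hd t ht).differentiableAt.differentiableWithinAt)
      hFc.continuousWithinAt hr (hlim hr hd)
    have h2 : HasDerivWithinAt F (G 0) (Iic 0) 0 := hasDerivWithinAt_Iic_of_tendsto_deriv
      (fun t ht => (hd' t ht).differentiableAt.differentiableWithinAt)
      hFc.continuousWithinAt hl (hlim hl hd')
    simpa using h2.union h1
  obtain ⟨s, hs, hts⟩ := hper.exists_mem_Ico₀ hL t
  refine hts.mpr ?_
  rcases hs.1.eq_or_lt with rfl | h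
  · exact h0
  · exact hd s ⟨h, hs.2⟩

/-- A positive arc of the first order system of the Chazy equation joining two points of `x = 0`
that are symmetric to each other extends to an antiperiodic solution. -/
theorem exists_periodic_of_arc {n : ℕ} {L ω : ℝ} (hL : 0 < L) {x p w : ℝ → ℝ}
    (hxc : ContinuousOn x (Icc 0 L)) (hpc : ContinuousOn p (Icc 0 L))
    (hwc : ContinuousOn w (Icc 0 L)) (hx0 : x 0 = 0) (hxL : x L = 0) (hpL : p L = -p 0)
    (hwL : w L = -w 0) (hpos : ∀ t ∈ Ioo 0 L, 0 < x t)
    (hx : ∀ t ∈ Ioo 0 L, HasDerivAt x (p t) t)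
    (hp : ∀ t ∈ Ioo 0 L, HasDerivAt p (w t - x t ^ (n + 1) * p t) t)
    (hw : ∀ t ∈ Ioo 0 L, HasDerivAt w (-(x t ^ n * p t ^ 2)) t)
    (henergy : ∀ t ∈ Icc 0 L, p t ^ 2 / 2 - x t * w t = ω ^ 2) :
    ∃ (T : ℝ) (x : ℝ → ℝ),
        0 < T ∧
        Function.Periodic x T ∧
        (¬ ∃ c : ℝ, ∀ t : ℝ, x t = c) ∧
        ContDiff ℝ 2 x ∧
        (∀ t : ℝ, x t ≠ 0 →
          DifferentiableAt ℝ (deriv (deriv x)) t ∧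
          deriv (deriv (deriv x)) t + |x t| ^ (n + 1) * deriv (deriv x) t
            + (((n + 1 : ℕ) : ℝ) + 1) * (|x t| ^ (n + 1) / x t) * (deriv x t) ^ 2 = 0) ∧
        (∀ t : ℝ, x t * deriv (deriv x) t - (deriv x t) ^ 2 / 2
            + |x t| ^ (n + 1) * x t * deriv x t = -ω ^ 2) := by
  obtain ⟨X, hXa, hXc, hX⟩ := exists_continuous_antiperiodic_eqOn hL hxc (by simp [hx0, hxL])
  obtain ⟨P, hPa, hPc, hP⟩ := exists_continuous_antiperiodic_eqOn hL hpc hpL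
  obtain ⟨W, hWa, hWc, hW⟩ := exists_continuous_antiperiodic_eqOn hL hwc hwL
  have hderiv : ∀ {f F : ℝ → ℝ}, EqOn F f (Icc 0 L) → ∀ {t f'}, t ∈ Ioo 0 L →
      HasDerivAt f f' t → HasDerivAt F f' t := fun h t _ ht hf =>
    hf.congr_of_eventuallyEq (eventually_of_mem (Icc_mem_nhds ht.1 ht.2) h)
  have hXpos : ∀ t ∈ Ioo 0 L, 0 < X t := fun t ht => by
    rw [hX (Ioo_subset_Icc_self ht)]
    exact hpos t ht
  set A : ℝ → ℝ := fun t => W t - |X t| ^ (n + 1) * P t with hA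
  set J : ℝ → ℝ := fun t => -(|X t| ^ (n + 1) * A t) -
    ((n : ℝ) + 2) * (|X t| ^ (n + 1) / X t) * P t ^ 2 with hJ
  have hAa : Function.Antiperiodic A L := fun t => by
    simp only [hA, hXa t, hPa t, hWa t, abs_neg]
    ring
  have hJa : Function.Antiperiodic J L := fun t => by
    simp only [hJ, hXa t, hPa t, hAa t, abs_neg, div_neg]
    ring
  have hXP : ∀ t, HasDerivAt X (P t) t :=
    hasDerivAt_of_antiperiodic_s4 hL hXa hPa hXc hPc fun t ht => by
      rw [hP (Ioo_subset_Icc_self ht)]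
      exact hderiv hX ht (hx t ht)
  have hPA : ∀ t, HasDerivAt P (A t) t :=
    hasDerivAt_of_antiperiodic_s4 hL hPa hAa hPc (by fun_prop) fun t ht => by
      simp only [hA, abs_of_pos (hXpos t ht)]
      rw [hX (Ioo_subset_Icc_self ht), hP (Ioo_subset_Icc_self ht), hW (Ioo_subset_Icc_self ht)]
      exact hderiv hP ht (hp t ht)
  have hAJ : ∀ t, X t ≠ 0 → HasDerivAt A (J t) t := by
    intro t
    have hper : Function.Periodic (fun t => X t ≠ 0 → HasDerivAt A (J t) t) L := fun t => by
      simp only [hXa t, neg_ne_zero, hasDerivAt_add_iff_of_antiperiodic hAa hJa]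
    obtain ⟨s, hs, hts⟩ := hper.exists_mem_Ico₀ hL t
    refine hts.mpr fun hs0 => ?_
    have hs' : s ∈ Ioo 0 L := by
      refine ⟨hs.1.lt_of_ne ?_, hs.2⟩
      rintro rfl
      exact hs0 (by rw [hX ⟨le_rfl, hL.le⟩, hx0])
    have hsc := Ioo_subset_Icc_self hs'
    have hWs : HasDerivAt W (-(X s ^ n * P s ^ 2)) s := by
      rw [hX hsc, hP hsc]
      exact hderiv hW hs' (hw s hs')
    have hmain : HasDerivAt (fun t => W t - X t ^ (n + 1) * P t) (J s) s := by
      refine (hWs.fun_sub (((hXP s).fun_pow (n + 1)).fun_mul (hPA s))).congr_deriv ?_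
      simp only [hJ, abs_of_pos (hXpos s hs'), pow_succ]
      rw [mul_div_cancel_right₀ _ hs0, hA]
      simp only [abs_of_pos (hXpos s hs'), Nat.add_sub_cancel]
      push_cast
      ring
    refine hmain.congr_of_eventuallyEq (eventually_of_mem (Ioo_mem_nhds hs'.1 hs'.2) fun r hr => ?_)
    simp only [hA, abs_of_pos (hXpos r hr)]
  have hdX : deriv X = P := funext fun t => (hXP t).deriv
  have hdP : deriv P = A := funext fun t => (hPA t).deriv
  have hAc : Continuous A := by fun_prop
  refine ⟨2 * L, X, by positivity, hXa.periodic_two_mul, ?_, ?_, ?_, ?_⟩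
  · rintro ⟨c, hc⟩
    have h1 : X 0 = 0 := by rw [hX ⟨le_rfl, hL.le⟩, hx0]
    have h2 := hXpos (L / 2) ⟨by linarith, by linarith⟩
    rw [hc] at h1 h2
    exact h2.ne' h1
  · rw [show (2 : WithTop ℕ∞) = 1 + 1 by norm_num, contDiff_succ_iff_deriv]
    refine ⟨fun t => (hXP t).differentiableAt, by simp, ?_⟩
    rw [hdX, contDiff_one_iff_deriv, hdP]
    exact ⟨fun t => (hPA t).differentiableAt, hAc⟩
  · intro t ht
    rw [hdX, hdP, (hAJ t ht).deriv]
    refine ⟨(hAJ t ht).differentiableAt, ?_⟩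
    simp only [hJ]
    push_cast
    ring
  · intro t
    rw [hdX, hdP]
    have hper : Function.Periodic (fun t => P t ^ 2 / 2 - X t * W t) L := fun t => by
      simp only [hXa t, hPa t, hWa t]
      ring
    obtain ⟨s, hs, hts⟩ := hper.exists_mem_Ico₀ hL t
    have hsc := Ico_subset_Icc_self hs
    simp only [hX hsc, hP hsc, hW hsc, henergy s hsc] at hts
    simp only [hA]
    linear_combination -hts

theorem exists_reparametrization {e : ℝ → ℝ} {a b : ℝ} (hab : a < b)
    (he : ContinuousOn e (Icc a b)) (hpos : ∀ x ∈ Ioo a b, 0 < e x) :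
    ∃ L > 0, ∃ g : ℝ → ℝ, Continuous g ∧ g 0 = a ∧ g L = b ∧
      ∀ t ∈ Ioo 0 L, g t ∈ Ioo a b ∧ HasDerivAt g (e (g t))⁻¹ t := by
  let E : ℝ → ℝ := IccExtend hab.le ((Icc a b).domRestrict e)
  have hE : Continuous E := he.domRestrict.Icc_extend'
  have hEe : ∀ x ∈ Ioo a b, E x = e x := fun x hx =>
    IccExtend_of_mem _ _ (Ioo_subset_Icc_self hx)
  let f : ℝ → ℝ := fun x => ∫ y in a..x, E y
  have hf : ∀ x, HasDerivAt f (E x) x := fun x => hE.integral_hasStrictDerivAt a x |>.hasDerivAt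
  have hfa : f a = 0 := intervalIntegral.integral_same
  obtain ⟨hlt, g, hg, hga, hgb, hgd⟩ := exists_inverse_hasDerivAt hab
    (fun x _ => (hf x).continuousAt.continuousWithinAt) (fun x _ => hf x)
    (fun x hx => (hEe x hx).symm ▸ hpos x hx)
  rw [hfa] at hlt hga hgd
  exact ⟨f b, hlt, g, hg, hga, hgb, fun t ht =>
    ⟨(hgd t ht).1, hEe _ (hgd t ht).1 ▸ (hgd t ht).2⟩⟩

theorem abs_inv_max_sqrt_pow_sub_le {ρ : ℝ} (hρ : 0 < ρ) (m : ℕ) (a b : ℝ) :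
    |((max √a ρ) ^ m)⁻¹ - ((max √b ρ) ^ m)⁻¹| ≤ m * ρ⁻¹ ^ (m + 2) * |a - b| := by
  have hsq : ∀ d, (max √d ρ) ^ 2 = max d (ρ ^ 2) := fun d => by
    rcases le_total (ρ ^ 2) d with h | h
    · rw [max_eq_left (Real.le_sqrt_of_sq_le h), max_eq_left h,
        Real.sq_sqrt ((sq_nonneg ρ).trans h)]
    · rw [max_eq_right ((Real.sqrt_le_left hρ.le).2 h), max_eq_right h]
  set r := max √a ρ with hr
  set s := max √b ρ with hs
  have hrρ : ρ ≤ r := le_max_right _ _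
  have hsρ : ρ ≤ s := le_max_right _ _
  have hr0 : 0 < r := hρ.trans_le hrρ
  have hs0 : 0 < s := hρ.trans_le hsρ
  have h1 : ρ * |r - s| ≤ |a - b| := by
    calc ρ * |r - s| ≤ (r + s) * |r - s| := by gcongr; linarith
      _ = |r ^ 2 - s ^ 2| := by rw [sq_sub_sq, abs_mul, abs_of_pos (add_pos hr0 hs0)]
      _ ≤ |a - b| := by
        rw [hsq, hsq]
        exact abs_max_sub_max_le_abs a b (ρ ^ 2)
  have h2 : |r⁻¹ - s⁻¹| ≤ ρ⁻¹ ^ 3 * |a - b| := by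
    rw [inv_sub_inv hr0.ne' hs0.ne', abs_div, abs_of_pos (mul_pos hr0 hs0), abs_sub_comm]
    calc |r - s| / (r * s) ≤ |r - s| / (ρ * ρ) := by gcongr
      _ = ρ⁻¹ ^ 3 * (ρ * |r - s|) := by field_simp
      _ ≤ _ := by gcongr
  have h3 : max |r⁻¹| |s⁻¹| ≤ ρ⁻¹ := by
    rw [abs_of_pos (inv_pos.2 hr0), abs_of_pos (inv_pos.2 hs0)]
    exact max_le (inv_anti₀ hρ hrρ) (inv_anti₀ hρ hsρ)
  rcases m with _ | m
  · simp
  rw [← inv_pow, ← inv_pow]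
  calc _ ≤ |r⁻¹ - s⁻¹| * (m + 1 : ℕ) * max |r⁻¹| |s⁻¹| ^ (m + 1 - 1) := abs_pow_sub_pow_le _ _ _
    _ ≤ (ρ⁻¹ ^ 3 * |a - b|) * (m + 1 : ℕ) * ρ⁻¹ ^ (m + 1 - 1) := by gcongr
    _ = _ := by rw [Nat.add_sub_cancel]; ring

/-- In the variable `θ`, with `x = sin² θ / r²` and `x' = 2 cos θ / r - 2 x^(n+2) / (2n+3)`,
arcs of the Chazy equation with `q = n + 1` on the level `-2/κ` solve a scalar equation that is
regular at both ends of the arc. -/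
theorem exists_chazy_profile (n : ℕ) {κ : ℝ} (hκ : 0 < κ) :
    ∃ z r : ℝ → ℝ, z Real.pi = -z 0 ∧ ∀ θ ∈ Icc 0 Real.pi, 0 < r θ ∧
      r θ ^ 2 = κ * Real.cos θ ^ 2 + z θ * Real.sin θ ^ 2 ∧
      HasDerivWithinAt z (2 * κ / (2 * n + 3) *
        (Real.sin θ * (Real.sin θ ^ 2 / r θ ^ 2) ^ n / r θ ^ 3)) (Icc 0 Real.pi) θ := by
  let D : ℝ → ℝ → ℝ := fun θ z => κ * Real.cos θ ^ 2 + z * Real.sin θ ^ 2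
  set k : ℝ := 2 * κ / (2 * n + 3) with hk
  have hk0 : 0 < k := by positivity
  set m : ℝ := min κ 1 with hm
  have hm0 : 0 < m := lt_min hκ one_pos
  set B : ℝ := k / √m ^ (2 * n + 3) with hB
  have hB0 : 0 ≤ B := by positivity
  set M : ℝ := B * Real.pi + 1 with hM
  have hM0 : 0 < M := by positivity
  set σ : ℝ := √(κ / 2 / (κ + M)) with hσ
  have hσ0 : 0 < σ := by positivity
  have hσ2 : σ ^ 2 * (κ + M) = κ / 2 := by
    rw [hσ, Real.sq_sqrt (by positivity)]
    field_simp
  obtain ⟨ρ, hρ0, hρ⟩ : ∃ ρ, 0 < ρ ∧ ρ < min (min 1 (κ / 2)) (σ ^ (2 * n + 4) / (2 * n + 3)) :=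
    exists_between (lt_min (lt_min one_pos (by positivity)) (by positivity))
  simp only [lt_min_iff] at hρ
  obtain ⟨⟨hρ1, hρκ⟩, hρσ⟩ := hρ
  have hρ2 : ρ ^ 2 ≤ κ / 2 := by nlinarith
  let h : ℝ → ℝ → ℝ := fun θ z =>
    k * Real.sin θ ^ (2 * n + 1) * ((max √(D θ z) ρ) ^ (2 * n + 3))⁻¹
  have hR : ∀ θ z, ρ ≤ max √(D θ z) ρ := fun θ z => le_max_right _ _
  have hR0 : ∀ θ z, 0 < max √(D θ z) ρ := fun θ z => hρ0.trans_le (hR θ z)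
  have hsin0 : ∀ θ ∈ Icc 0 Real.pi, 0 ≤ Real.sin θ := fun θ hθ =>
    Real.sin_nonneg_of_nonneg_of_le_pi hθ.1 hθ.2
  have hcoef0 : ∀ θ ∈ Icc 0 Real.pi, 0 ≤ k * Real.sin θ ^ (2 * n + 1) := fun θ hθ =>
    mul_nonneg hk0.le (pow_nonneg (hsin0 θ hθ) _)
  have hcoef1 : ∀ θ ∈ Icc 0 Real.pi, k * Real.sin θ ^ (2 * n + 1) ≤ k := fun θ hθ =>
    mul_le_of_le_one_right hk0.le (pow_le_one₀ (hsin0 θ hθ) (Real.sin_le_one θ))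
  have hnonneg : ∀ θ ∈ Icc 0 Real.pi, ∀ z, 0 ≤ h θ z := fun θ hθ z =>
    mul_nonneg (hcoef0 θ hθ) (inv_nonneg.2 (pow_nonneg (hR0 θ z).le _))
  have hLip : ∀ θ ∈ Icc 0 Real.pi, LipschitzWith
      (k * ((2 * n + 3 : ℕ) * ρ⁻¹ ^ (2 * n + 3 + 2))).toNNReal (h θ) := fun θ hθ => by
    refine LipschitzWith.of_dist_le' fun y z => ?_
    simp only [Real.dist_eq, h]
    have hDyz : |D θ y - D θ z| ≤ |y - z| := by
      have : D θ y - D θ z = (y - z) * Real.sin θ ^ 2 := by simp only [D]; ring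
      rw [this, abs_mul, abs_of_nonneg (sq_nonneg (Real.sin θ))]
      exact mul_le_of_le_one_right (abs_nonneg _) (Real.sin_sq_le_one θ)
    rw [← mul_sub, abs_mul, abs_of_nonneg (hcoef0 θ hθ), mul_assoc k (_ * _)]
    exact mul_le_mul (hcoef1 θ hθ) ((abs_inv_max_sqrt_pow_sub_le hρ0 _ _ _).trans
      (mul_le_mul_of_nonneg_left hDyz (by positivity))) (abs_nonneg _) hk0.le
  have hcont : ∀ z, ContinuousOn (fun θ => h θ z) (Icc 0 Real.pi) := fun z => by
    refine Continuous.continuousOn ?_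
    simp only [h, D]
    exact (by fun_prop : Continuous fun θ => k * Real.sin θ ^ (2 * n + 1)).mul
      (Continuous.inv₀ (by fun_prop) fun θ => (pow_pos (hR0 θ z) _).ne')
  have hbd : ∀ θ ∈ Icc 0 Real.pi, ∀ z, |h θ z| ≤ ((k * (ρ ^ (2 * n + 3))⁻¹).toNNReal : ℝ) :=
    fun θ hθ z => by
      rw [abs_of_nonneg (hnonneg θ hθ z)]
      refine le_trans ?_ (Real.le_coe_toNNReal _)
      exact mul_le_mul (hcoef1 θ hθ) (inv_anti₀ (by positivity)
        (pow_le_pow_left₀ hρ0.le (hR θ z) _)) (inv_nonneg.2 (pow_nonneg (hR0 θ z).le _)) hk0.le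
  have hanti : ∀ θ ∈ Icc 0 Real.pi, Antitone (h θ) := fun θ hθ y z hyz => by
    refine mul_le_mul_of_nonneg_left (inv_anti₀ (pow_pos (hR0 θ y) _)
      (pow_le_pow_left₀ (hR0 θ y).le ?_ _)) (hcoef0 θ hθ)
    simp only [D]
    gcongr
  have hhB : ∀ θ ∈ Icc 0 Real.pi, h θ 1 ≤ B := fun θ hθ => by
    rw [hB, div_eq_mul_inv]
    refine mul_le_mul (hcoef1 θ hθ) (inv_anti₀ (by positivity)
      (pow_le_pow_left₀ (by positivity) ((Real.sqrt_le_sqrt ?_).trans (le_max_left _ _)) _))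
      (inv_nonneg.2 (pow_nonneg (hR0 θ 1).le _)) hk0.le
    have h1 : m ≤ κ := min_le_left _ _
    have h2 : m ≤ 1 := min_le_right _ _
    simp only [D]
    nlinarith [Real.sin_sq_add_cos_sq θ, sq_nonneg (Real.sin θ), sq_nonneg (Real.cos θ)]
  obtain ⟨z, hzπ, hzM, hz⟩ := exists_solution_endpoint_eq_neg Real.pi_pos.le hLip hcont hbd hanti
    hnonneg hB0 hhB
  have hDd : ∀ θ ∈ Icc 0 Real.pi, HasDerivWithinAt (fun θ => D θ (z θ))
      (2 * Real.sin θ * Real.cos θ * (z θ - κ) + h θ (z θ) * Real.sin θ ^ 2)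
      (Icc 0 Real.pi) θ := fun θ hθ => by
    refine ((((Real.hasDerivAt_cos θ).fun_pow 2).const_mul κ).hasDerivWithinAt.fun_add
      ((hz θ hθ).fun_mul ((Real.hasDerivAt_sin θ).fun_pow 2).hasDerivWithinAt)).congr_deriv ?_
    norm_num
    ring
  have hDρ : ∀ θ ∈ Icc 0 Real.pi, ρ ^ 2 ≤ D θ (z θ) := by
    have := image_le_of_deriv_right_lt_deriv_boundary' (f := fun _ => ρ ^ 2) (f' := fun _ => 0)
      continuousOn_const (fun x _ => hasDerivWithinAt_const _ _ _)
      (B := fun θ => D θ (z θ))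
      (B' := fun θ => 2 * Real.sin θ * Real.cos θ * (z θ - κ) + h θ (z θ) * Real.sin θ ^ 2)
      (a := 0) (b := Real.pi) (by simp [D]; linarith)
      (fun θ hθ => (hDd θ hθ).continuousWithinAt)
      (fun θ hθ => (hDd θ (Ico_subset_Icc_self hθ)).mono_of_mem_nhdsWithin
        (Icc_mem_nhdsGE_of_mem hθ)) ?_
    · exact fun θ hθ => this hθ
    intro θ hθ hθρ
    have hθ' := Ico_subset_Icc_self hθ
    set s := Real.sin θ with hs
    set c := Real.cos θ with hc
    have hsc : s ^ 2 + c ^ 2 = 1 := Real.sin_sq_add_cos_sq θ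
    have hs0 : 0 ≤ s := hsin0 θ hθ'
    have hD1 : s ^ 2 * (κ - z θ) = κ - ρ ^ 2 := by
      rw [hθρ]
      simp only [D, ← hs, ← hc]
      linear_combination κ * hsc
    have hσs : σ ≤ s := by
      have h1 := hzM θ hθ'
      have h2 : σ ^ 2 * (κ + M) ≤ s ^ 2 * (κ + M) := by
        nlinarith [sq_nonneg s]
      exact (pow_le_pow_iff_left₀ hσ0.le hs0 two_ne_zero).1
        (le_of_mul_le_mul_right h2 (by positivity))
    have hs0' : 0 < s := hσ0.trans_le hσs
    have hmax : max √(D θ (z θ)) ρ = ρ := by rw [← hθρ, Real.sqrt_sq hρ0.le, max_self]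
    have hlarge : 2 * κ < h θ (z θ) * s ^ 3 := by
      simp only [h, hmax, ← hs]
      have h1 : ρ ^ (2 * n + 3) ≤ ρ := pow_le_of_le_one hρ0.le hρ1.le (by simp)
      have h2 : σ ^ (2 * n + 4) ≤ s ^ (2 * n + 4) := by gcongr
      have h3 : ρ ^ (2 * n + 3) * (2 * n + 3) < s ^ (2 * n + 4) := by
        rw [lt_div_iff₀ (by positivity)] at hρσ
        nlinarith
      rw [show k * s ^ (2 * n + 1) * (ρ ^ (2 * n + 3))⁻¹ * s ^ 3 =
        2 * κ * (s ^ (2 * n + 4) / (ρ ^ (2 * n + 3) * (2 * n + 3))) by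
          rw [hk]; field_simp; ring]
      exact lt_mul_of_one_lt_right (by positivity) ((one_lt_div (by positivity)).2 h3)
    have hc1 : c ≤ 1 := Real.cos_le_one θ
    have hpos : 0 < s * (2 * s * c * (z θ - κ) + h θ (z θ) * s ^ 2) := by
      have : s * (2 * s * c * (z θ - κ) + h θ (z θ) * s ^ 2) =
          h θ (z θ) * s ^ 3 - 2 * c * (κ - ρ ^ 2) := by
        linear_combination (-2 * c) * hD1
      rw [this]
      nlinarith [sq_nonneg ρ]
    exact pos_of_mul_pos_right hpos hs0
  have hr0 : ∀ θ ∈ Icc 0 Real.pi, ρ ≤ √(D θ (z θ)) := fun θ hθ => Real.le_sqrt_of_sq_le (hDρ θ hθ)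
  refine ⟨z, fun θ => √(D θ (z θ)), hzπ, fun θ hθ => ⟨hρ0.trans_le (hr0 θ hθ),
    Real.sq_sqrt ((sq_nonneg ρ).trans (hDρ θ hθ)), (hz θ hθ).congr_deriv ?_⟩⟩
  have := hρ0.trans_le (hr0 θ hθ)
  simp only [h, max_eq_left (hr0 θ hθ)]
  rw [div_pow]
  field_simp
  ring

/-- An arc of the Chazy equation in physical time, written as a polynomial first order system. -/
theorem exists_chazy_arc (n : ℕ) {κ : ℝ} (hκ : 0 < κ) :
    ∃ L > 0, ∃ x C z : ℝ → ℝ, ContinuousOn x (Icc 0 L) ∧ ContinuousOn C (Icc 0 L) ∧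
      ContinuousOn z (Icc 0 L) ∧ x 0 = 0 ∧ x L = 0 ∧ C L = -C 0 ∧ z L = -z 0 ∧
      (∀ t ∈ Icc 0 L, κ * C t ^ 2 + z t * x t = 1) ∧
      ∀ t ∈ Ioo 0 L, 0 < x t ∧
        HasDerivAt x (2 * C t - 2 / (2 * n + 3) * x t ^ (n + 2)) t ∧
        HasDerivAt C (-(z t / κ) - C t * x t ^ (n + 1) / (2 * n + 3)) t ∧
        HasDerivAt z (2 / (2 * n + 3) * x t ^ n) t := by
  obtain ⟨z, r, hzπ, hzr⟩ := exists_chazy_profile n hκ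
  have hr0 : ∀ θ ∈ Icc 0 Real.pi, 0 < r θ := fun θ hθ => (hzr θ hθ).1
  have hr2 : ∀ θ ∈ Icc 0 Real.pi, r θ ^ 2 = κ * Real.cos θ ^ 2 + z θ * Real.sin θ ^ 2 :=
    fun θ hθ => (hzr θ hθ).2.1
  have hrs : EqOn r (fun θ => √(κ * Real.cos θ ^ 2 + z θ * Real.sin θ ^ 2)) (Icc 0 Real.pi) :=
    fun θ hθ => by
      simp only [← hr2 θ hθ]
      rw [Real.sqrt_sq (hr0 θ hθ).le]
  have hzc : ContinuousOn z (Icc 0 Real.pi) := fun θ hθ => (hzr θ hθ).2.2.continuousWithinAt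
  have hrc : ContinuousOn r (Icc 0 Real.pi) := by
    refine ContinuousOn.congr ?_ hrs
    fun_prop
  set e : ℝ → ℝ := fun θ => κ * Real.sin θ / r θ ^ 3 with he
  have hec : ContinuousOn e (Icc 0 Real.pi) :=
    ContinuousOn.div (by fun_prop) (by fun_prop) fun θ hθ => (pow_pos (hr0 θ hθ) _).ne'
  have hepos : ∀ θ ∈ Ioo 0 Real.pi, 0 < e θ := fun θ hθ =>
    div_pos (mul_pos hκ (Real.sin_pos_of_mem_Ioo hθ)) (pow_pos (hr0 θ (Ioo_subset_Icc_self hθ)) _)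
  obtain ⟨L, hL, g, hg, hg0, hgL, hgd⟩ := exists_reparametrization Real.pi_pos hec hepos
  have hgm : MapsTo g (Icc 0 L) (Icc 0 Real.pi) := fun t ht => by
    rcases ht.1.eq_or_lt with rfl | h0
    · rw [hg0]; exact ⟨le_rfl, Real.pi_pos.le⟩
    rcases ht.2.eq_or_lt with rfl | h1
    · rw [hgL]; exact ⟨Real.pi_pos.le, le_rfl⟩
    · exact Ioo_subset_Icc_self (hgd t ⟨h0, h1⟩).1
  let x : ℝ → ℝ := fun θ => Real.sin θ ^ 2 / r θ ^ 2
  let C : ℝ → ℝ := fun θ => Real.cos θ / r θ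
  have hxc : ContinuousOn x (Icc 0 Real.pi) :=
    ContinuousOn.div (by fun_prop) (by fun_prop) fun θ hθ => (pow_pos (hr0 θ hθ) _).ne'
  have hCc : ContinuousOn C (Icc 0 Real.pi) :=
    ContinuousOn.div (by fun_prop) (by fun_prop) fun θ hθ => (hr0 θ hθ).ne'
  have hr0π : r Real.pi = r 0 := by
    rw [hrs ⟨le_rfl, Real.pi_pos.le⟩, hrs ⟨Real.pi_pos.le, le_rfl⟩]
    simp
  refine ⟨L, hL, x ∘ g, C ∘ g, z ∘ g, hxc.comp hg.continuousOn hgm, hCc.comp hg.continuousOn hgm,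
    hzc.comp hg.continuousOn hgm, by simp [x, hg0], by simp [x, hgL],
    by simp [C, hg0, hgL, hr0π, neg_div], by simp [hg0, hgL, hzπ], fun t ht => ?_, fun t ht => ?_⟩
  · have h1 := hr0 _ (hgm ht)
    have h2 := hr2 _ (hgm ht)
    simp only [Function.comp_apply, x, C]
    field_simp
    linear_combination -h2
  obtain ⟨hθ, hgt⟩ := hgd t ht
  have hlift : ∀ {f : ℝ → ℝ} {f' : ℝ}, HasDerivAt f (f' * e (g t)) (g t) →
      HasDerivAt (f ∘ g) f' t := fun h => by
    refine (h.comp t hgt).congr_deriv ?_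
    rw [mul_assoc, mul_inv_cancel₀ (hepos _ hθ).ne', mul_one]
  simp only [Function.comp_apply]
  set θ := g t
  have hθ' := Ioo_subset_Icc_self hθ
  have hN : (2 * n + 3 : ℝ) ≠ 0 := by positivity
  have hr := hr0 θ hθ'
  have hs := Real.sin_pos_of_mem_Ioo hθ
  have hD := hr2 θ hθ'
  have hsc := Real.sin_sq_add_cos_sq θ
  have hz' : HasDerivAt z (2 * κ / (2 * n + 3) *
      (Real.sin θ * (Real.sin θ ^ 2 / r θ ^ 2) ^ n / r θ ^ 3)) θ :=
    (hzr θ hθ').2.2.hasDerivAt (Icc_mem_nhds hθ.1 hθ.2)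
  have hr' : HasDerivAt r ((2 * Real.sin θ * Real.cos θ * (z θ - κ) + 2 * κ / (2 * n + 3) *
      (Real.sin θ * (Real.sin θ ^ 2 / r θ ^ 2) ^ n / r θ ^ 3) * Real.sin θ ^ 2) /
        (2 * r θ)) θ := by
    have h1 := (((Real.hasDerivAt_cos θ).fun_pow 2).const_mul κ).fun_add
      (hz'.fun_mul ((Real.hasDerivAt_sin θ).fun_pow 2))
    have h2 := (h1.sqrt (hD ▸ (pow_pos hr 2).ne')).congr_of_eventuallyEq
      (eventually_of_mem (Icc_mem_nhds hθ.1 hθ.2) hrs)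
    refine h2.congr_deriv ?_
    rw [← hD, Real.sqrt_sq hr.le]
    norm_num
    ring
  have hxpow : ∀ j, x θ ^ (n + j) =
      (Real.sin θ ^ 2 / r θ ^ 2) ^ n * (Real.sin θ ^ 2 / r θ ^ 2) ^ j := fun j => pow_add _ _ _
  refine ⟨by positivity, hlift ?_, hlift ?_, hlift ?_⟩
  · refine (((Real.hasDerivAt_sin θ).fun_pow 2).fun_div (hr'.fun_pow 2)
      (pow_pos hr 2).ne').congr_deriv ?_
    rw [hxpow]
    simp only [C, he]
    generalize (Real.sin θ ^ 2 / r θ ^ 2) ^ n = Y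
    generalize Real.sin θ = s at *
    generalize Real.cos θ = c at *
    rw [← sub_eq_zero]
    trans 2 * s * c / r θ ^ 4 * (r θ ^ 2 - s ^ 2 * z θ + κ * s ^ 2 - κ)
    · norm_num
      field_simp
      ring
    · rw [hD]
      linear_combination (2 * s * c / r θ ^ 4) * κ * hsc
  · refine ((Real.hasDerivAt_cos θ).fun_div hr' hr.ne').congr_deriv ?_
    rw [hxpow]
    simp only [C, he]
    generalize (Real.sin θ ^ 2 / r θ ^ 2) ^ n = Y
    generalize Real.sin θ = s at *
    generalize Real.cos θ = c at *
    rw [← sub_eq_zero]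
    trans s / r θ ^ 3 * (-r θ ^ 2 + κ * c ^ 2 - z θ * c ^ 2 + z θ)
    · field_simp
      ring
    · rw [hD]
      linear_combination (-s / r θ ^ 3) * z θ * hsc
  · refine hz'.congr_deriv ?_
    simp only [x, he]
    ring

end

/-- For `k = q + 1` and `1 ≤ q ≤ 100`, the generalized Chazy equation
`x''' + |x|^q x'' + (q+1)(|x|^q/x) x'^2 = 0` has, on each negative energy level
`H = x x'' - x'^2/2 + |x|^q x x' = -ω^2`, a nonconstant periodic solution. -/
theorem chazy_q_le_100_periodic_orbits (q : ℕ) (hq1 : 1 ≤ q) (hq2 : q ≤ 100) :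
    ∀ ω : ℝ, 0 < ω →
      ∃ (T : ℝ) (x : ℝ → ℝ),
        0 < T ∧
        Function.Periodic x T ∧
        (¬ ∃ c : ℝ, ∀ t : ℝ, x t = c) ∧
        ContDiff ℝ 2 x ∧
        (∀ t : ℝ, x t ≠ 0 →
          DifferentiableAt ℝ (deriv (deriv x)) t ∧
          deriv (deriv (deriv x)) t + |x t| ^ q * deriv (deriv x) t
            + ((q : ℝ) + 1) * (|x t| ^ q / x t) * (deriv x t) ^ 2 = 0) ∧
        (∀ t : ℝ, x t * deriv (deriv x) t - (deriv x t) ^ 2 / 2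
            + |x t| ^ q * x t * deriv x t = -ω ^ 2) := by
  intro ω hω
  obtain ⟨n, rfl⟩ : ∃ n, q = n + 1 := ⟨q - 1, by omega⟩
  obtain ⟨κ, hκ, hκω⟩ : ∃ κ : ℝ, 0 < κ ∧ ω ^ 2 = 2 / κ := ⟨2 / ω ^ 2, by positivity, by field_simp⟩
  obtain ⟨L, hL, x, C, z, hxc, hCc, hzc, hx0, hxL, hCL, hzL, hxz, hd⟩ := exists_chazy_arc n hκ
  have hN : (2 * n + 3 : ℝ) ≠ 0 := by positivity
  refine exists_periodic_of_arc (n := n) hL (x := x)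
    (p := fun t => 2 * C t - 2 / (2 * n + 3) * x t ^ (n + 2))
    (w := fun t => -(2 / κ * z t) - 4 / (2 * n + 3) * (C t * x t ^ (n + 1)) +
      2 / (2 * n + 3) ^ 2 * x t ^ (2 * n + 3))
    hxc (by fun_prop) (by fun_prop) hx0 hxL (by simp [hx0, hxL, hCL])
    (by simp [hx0, hxL, hzL]) (fun t ht => (hd t ht).1) (fun t ht => (hd t ht).2.1)
    (fun t ht => ?_) (fun t ht => ?_) (fun t ht => ?_)
  · obtain ⟨-, h1, h2, -⟩ := hd t ht
    refine ((h2.const_mul 2).fun_sub ((h1.fun_pow (n + 2)).const_mul _)).congr_deriv ?_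
    simp only [show n + 2 - 1 = n + 1 by omega]
    push_cast
    field_simp
    ring
  · obtain ⟨-, h1, h2, h3⟩ := hd t ht
    refine (((h3.const_mul (2 / κ)).fun_neg.fun_sub
      ((h2.fun_mul (h1.fun_pow (n + 1))).const_mul _)).fun_add
      ((h1.fun_pow (2 * n + 3)).const_mul _)).congr_deriv ?_
    have h4 := hxz t (Set.Ioo_subset_Icc_self ht)
    simp only [show 2 * n + 3 - 1 = 2 * n + 2 by omega, Nat.add_sub_cancel]
    push_cast
    rw [← sub_eq_zero]
    trans 4 * x t ^ n / ((2 * n + 3) * κ) * (κ * C t ^ 2 + z t * x t - 1)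
    · field_simp
      ring
    · rw [h4]; ring
  · have h4 := hxz t ht
    rw [hκω, ← sub_eq_zero]
    trans 2 / κ * (κ * C t ^ 2 + z t * x t - 1)
    · field_simp
      ring
    · rw [h4]; ring
end

section
/- Let q be a positive integer and let I ⊆ ℝ be an open interval. Suppose x : I → ℝ is three times differentiable on I, x(t) ≠ 0 for all t ∈ I, and x'''(t) + |x(t)|^q x''(t) + (q+1)(|x(t)|^q/x(t)) x'(t)² = 0 for all t ∈ I. Then the function t ↦ x(t)·x''(t) − x'(t)²/2 + |x(t)|^q·x(t)·x'(t) is constant on I. -/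
/-- Away from zero, `y ↦ |y| ^ q * y` has derivative `(q + 1) * |y| ^ q`. -/
theorem hasDerivAt_abs_pow_mul_self (q : ℕ) {y : ℝ} (hy : y ≠ 0) :
    HasDerivAt (fun z : ℝ => |z| ^ q * z) (((q : ℝ) + 1) * |y| ^ q) y := by
  refine (((hasDerivAt_abs hy).pow q).mul (hasDerivAt_id y)).congr_deriv ?_
  cases q with
  | zero => simp
  | succ n =>
    have h : (SignType.sign y : ℝ) * y = |y| := sign_mul_self y
    simp only [Pi.pow_apply, id, Nat.add_sub_cancel]
    push_cast
    linear_combination ((n : ℝ) + 1) * |y| ^ n * h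

/-- First integral: if `x` solves the generalized Chazy equation with `k = q + 1`
on an open interval `I` where `x` does not vanish, then
`H = x x'' - x'^2/2 + |x|^q x x'` is constant on `I`. -/
theorem chazy_first_integral (q : ℕ) (hq : 1 ≤ q) (I : Set ℝ)
    (hIopen : IsOpen I) (hIinterval : I.OrdConnected) (x : ℝ → ℝ)
    (hx : ∀ t ∈ I, DifferentiableAt ℝ x t)
    (hx' : ∀ t ∈ I, DifferentiableAt ℝ (deriv x) t)
    (hx'' : ∀ t ∈ I, DifferentiableAt ℝ (deriv (deriv x)) t)
    (hne : ∀ t ∈ I, x t ≠ 0)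
    (hode : ∀ t ∈ I,
      deriv (deriv (deriv x)) t + |x t| ^ q * deriv (deriv x) t
        + ((q : ℝ) + 1) * (|x t| ^ q / x t) * (deriv x t) ^ 2 = 0) :
    ∃ c : ℝ, ∀ t ∈ I,
      x t * deriv (deriv x) t - (deriv x t) ^ 2 / 2
        + |x t| ^ q * x t * deriv x t = c := by
  have hderiv : ∀ t ∈ I, HasDerivAt
      (fun s => x s * deriv (deriv x) s - (deriv x s) ^ 2 / 2 + |x s| ^ q * x s * deriv x s)
      0 t := by
    intro t ht
    have h₀ := (hx t ht).hasDerivAt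
    have h₁ := (hx' t ht).hasDerivAt
    have h₂ := (hx'' t ht).hasDerivAt
    have hpow : HasDerivAt (fun s => |x s| ^ q * x s)
        (((q : ℝ) + 1) * |x t| ^ q * deriv x t) t :=
      (hasDerivAt_abs_pow_mul_self q (hne t ht)).comp t h₀
    refine (((h₀.mul h₂).sub ((h₁.pow 2).div_const 2)).add (hpow.mul h₁)).congr_deriv ?_
    have hcancel : |x t| ^ q / x t * x t = |x t| ^ q := div_mul_cancel₀ _ (hne t ht)
    norm_num
    linear_combination x t * hode t ht - ((q : ℝ) + 1) * (deriv x t) ^ 2 * hcancel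
  exact hIopen.exists_is_const_of_deriv_eq_zero hIinterval.isPreconnected
    (fun t ht => (hderiv t ht).differentiableAt.differentiableWithinAt)
    (fun t ht => (hderiv t ht).deriv)
end

section
/- Let q be a positive integer and define P(x) = −q − 2^{1/(2(1+q))}·(1+q)^{(2+q)/(1+q)}·x + √2·(1+q)·x^{1+q}. Then P has exactly one positive real zero x_{i,q}^I, and moreover x_{i,q}^I < 2. -/
/-- A polynomial `-a - b x + s x ^ (1 + q)` with `a, s > 0` has at most one positive zero. -/
theorem trinomial_pos_zero_not_lt {a b s : ℝ} {q : ℕ} (ha : 0 < a) (hs : 0 < s) {x y : ℝ}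
    (hx : 0 < x) (hxy : x < y) (hPx : -a - b * x + s * x ^ (1 + q) = 0)
    (hPy : -a - b * y + s * y ^ (1 + q) = 0) : False := by
  have hy : 0 < y := hx.trans hxy
  have hpow : x ^ q ≤ y ^ q := pow_le_pow_left₀ hx.le hxy.le q
  have key : a * (y - x) + s * (x * y) * (y ^ q - x ^ q) = 0 := by
    rw [pow_add, pow_one] at hPx hPy
    linear_combination x * hPy - y * hPx
  have h₁ : 0 < a * (y - x) := mul_pos ha (sub_pos.2 hxy)
  have h₂ : 0 ≤ s * (x * y) * (y ^ q - x ^ q) :=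
    mul_nonneg (by positivity) (sub_nonneg.2 hpow)
  linarith

theorem rpow_mul_rpow_one_div_le_two {n : ℕ} (hn : 2 ≤ n) :
    (2 : ℝ) ^ ((1 : ℝ) / (2 * n)) * (n : ℝ) ^ ((1 : ℝ) / n) ≤ 2 := by
  have hn0 : (n : ℝ) ≠ 0 := by positivity
  refine le_of_pow_le_pow_left₀ (n := n) (by omega) zero_le_two ?_
  rw [mul_pow, ← Real.rpow_mul_natCast zero_le_two, ← Real.rpow_mul_natCast n.cast_nonneg,
    show (1 : ℝ) / (2 * n) * n = 1 / 2 by field_simp, one_div_mul_cancel hn0, Real.rpow_one,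
    ← Real.sqrt_eq_rpow]
  have h₁ : Real.sqrt 2 ≤ 2 := Real.sqrt_le_iff.2 ⟨by norm_num, by norm_num⟩
  have h₂ : 2 * n ≤ 2 ^ n := by
    induction n, hn using Nat.le_induction with
    | base => norm_num
    | succ k hk ih =>
      have := ih (by positivity)
      rw [pow_succ]
      omega
  calc Real.sqrt 2 * n ≤ 2 * n := by gcongr
    _ ≤ 2 ^ n := by exact_mod_cast h₂

/-- The polynomial `P(x) = -q - 2^{1/(2(1+q))} (1+q)^{(2+q)/(1+q)} x + √2 (1+q) x^{1+q}`
has exactly one positive real zero, and this zero is smaller than `2`. -/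
theorem chazy_P_unique_positive_zero (q : ℕ) (hq : 1 ≤ q) :
    ∃ x : ℝ, 0 < x ∧
      (-(q : ℝ) - (2 : ℝ) ^ ((1 : ℝ) / (2 * (1 + (q : ℝ))))
          * (1 + (q : ℝ)) ^ ((2 + (q : ℝ)) / (1 + (q : ℝ))) * x
          + Real.sqrt 2 * (1 + (q : ℝ)) * x ^ (1 + q) = 0) ∧
      x < 2 ∧
      (∀ y : ℝ, 0 < y →
        (-(q : ℝ) - (2 : ℝ) ^ ((1 : ℝ) / (2 * (1 + (q : ℝ))))
            * (1 + (q : ℝ)) ^ ((2 + (q : ℝ)) / (1 + (q : ℝ))) * y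
            + Real.sqrt 2 * (1 + (q : ℝ)) * y ^ (1 + q) = 0) → y = x) := by
  have hq' : (0 : ℝ) < q := by exact_mod_cast hq
  have hb : (2 : ℝ) ^ ((1 : ℝ) / (2 * (1 + (q : ℝ))))
      * (1 + (q : ℝ)) ^ ((2 + (q : ℝ)) / (1 + (q : ℝ))) ≤ 2 * (1 + q) := by
    have h := rpow_mul_rpow_one_div_le_two (n := 1 + q) (by omega)
    push_cast at h
    rw [show (2 + (q : ℝ)) / (1 + q) = 1 / (1 + q) + 1 by field_simp; ring,
      Real.rpow_add_one (by positivity), ← mul_assoc]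
    gcongr
  set b := (2 : ℝ) ^ ((1 : ℝ) / (2 * (1 + (q : ℝ))))
      * (1 + (q : ℝ)) ^ ((2 + (q : ℝ)) / (1 + (q : ℝ)))
  have hs : 5 / 4 < Real.sqrt 2 := Real.lt_sqrt_of_sq_lt (by norm_num)
  have hs' : 0 < Real.sqrt 2 * (1 + (q : ℝ)) := by positivity
  have hP2 : 0 < -(q : ℝ) - b * 2 + Real.sqrt 2 * (1 + (q : ℝ)) * 2 ^ (1 + q) := by
    have h4 : (4 : ℝ) ≤ 2 ^ (1 + q) := by
      calc (4 : ℝ) = 2 ^ 2 := by norm_num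
        _ ≤ 2 ^ (1 + q) := pow_le_pow_right₀ one_le_two (by omega)
    have h5 : 5 / 4 * (1 + (q : ℝ)) * 4 ≤ Real.sqrt 2 * (1 + (q : ℝ)) * 2 ^ (1 + q) := by
      gcongr
    linarith
  have hcont : ContinuousOn
      (fun x : ℝ => -(q : ℝ) - b * x + Real.sqrt 2 * (1 + (q : ℝ)) * x ^ (1 + q))
      (Set.Icc 0 2) := by fun_prop
  obtain ⟨x, ⟨hx0, hx2⟩, hx⟩ := intermediate_value_Ioo zero_le_two hcont
    (show (0 : ℝ) ∈ Set.Ioo _ _ from ⟨by simpa using Nat.pos_of_ne_zero (by omega), hP2⟩)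
  refine ⟨x, hx0, hx, hx2, fun y hy hPy => ?_⟩
  rcases lt_trichotomy y x with h | h | h
  · exact (trinomial_pos_zero_not_lt hq' hs' hy h hPy hx).elim
  · exact h
  · exact (trinomial_pos_zero_not_lt hq' hs' hx0 h hx hPy).elim
end

section
/- For every positive integer q, one has −q + 2^{(3+2q)/2}·(1+q) − 2^{(3+2q)/(2(1+q))}·(1+q)^{(2+q)/(1+q)} > 0. (That is, P(2) > 0 where P(x) = −q − 2^{1/(2(1+q))}(1+q)^{(2+q)/(1+q)} x + √2(1+q)x^{1+q}.) -/
theorem sqrt_two_mul_le_two_pow {n : ℕ} (hn : 2 ≤ n) : √2 * (n : ℝ) ≤ 2 ^ n := by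
  have hs : √2 ≤ 2 := Real.sqrt_le_iff.mpr ⟨by norm_num, by norm_num⟩
  induction n, hn using Nat.le_induction with
  | base => push_cast; linarith
  | succ k hk ih =>
    have hk' : (1 : ℝ) ≤ k := by exact_mod_cast (by omega : 1 ≤ k)
    have := mul_le_mul_of_nonneg_left hk' (Real.sqrt_nonneg 2)
    rw [pow_succ]
    push_cast
    linarith

/-- `P(2) > 0` for `P(x) = -q - 2^{1/(2(1+q))}(1+q)^{(2+q)/(1+q)} x + √2(1+q)x^{1+q}`:
for every positive integer `q`,
`-q + 2^{(3+2q)/2} (1+q) - 2^{(3+2q)/(2(1+q))} (1+q)^{(2+q)/(1+q)} > 0`. -/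
theorem chazy_P_at_two_pos (q : ℕ) (hq : 1 ≤ q) :
    0 < -(q : ℝ) + (2 : ℝ) ^ ((3 + 2 * (q : ℝ)) / 2) * (1 + (q : ℝ))
      - (2 : ℝ) ^ ((3 + 2 * (q : ℝ)) / (2 * (1 + (q : ℝ))))
        * (1 + (q : ℝ)) ^ ((2 + (q : ℝ)) / (1 + (q : ℝ))) := by
  have hn : 2 ≤ q + 1 := by omega
  have hpow := sqrt_two_mul_le_two_pow hn
  push_cast at hpow
  set x : ℝ := 1 + (q : ℝ) with hx
  have hx0 : 0 < x := by positivity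
  set A : ℝ := (2 : ℝ) ^ ((3 + 2 * (q : ℝ)) / 2) with hA
  have hA_eq : A = 2 ^ (q + 1) * √2 := by
    rw [hA, Real.sqrt_eq_rpow, ← Real.rpow_natCast, ← Real.rpow_add two_pos]
    congr 1
    push_cast
    ring
  have hA_ge : 5 ≤ A := by
    have h4 : (2 : ℝ) ^ 2 ≤ 2 ^ (q + 1) := pow_le_pow_right₀ one_le_two hn
    have hs : (5 / 4 : ℝ) ≤ √2 := Real.le_sqrt_of_sq_le (by norm_num)
    rw [hA_eq]
    nlinarith
  have hroot : (A * x) ^ (1 / x) ≤ 4 := by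
    have hle : A * x ≤ (4 : ℝ) ^ x := by
      have h4 : (4 : ℝ) ^ x = 2 ^ (q + 1) * 2 ^ (q + 1) := by
        rw [← mul_pow, ← Real.rpow_natCast, hx]
        push_cast
        norm_num [add_comm]
      rw [h4, hA_eq, mul_assoc]
      gcongr
      rwa [hx, add_comm]
    calc (A * x) ^ (1 / x) ≤ ((4 : ℝ) ^ x) ^ (1 / x) := by gcongr
      _ = 4 := by
        rw [← Real.rpow_mul (by norm_num), mul_one_div_cancel hx0.ne', Real.rpow_one]
  have hterm : (2 : ℝ) ^ ((3 + 2 * (q : ℝ)) / (2 * x)) * x ^ ((2 + (q : ℝ)) / x)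
      = (A * x) ^ (1 / x) * x := by
    rw [Real.mul_rpow (by positivity) hx0.le, hA, ← Real.rpow_mul two_pos.le, mul_assoc,
      ← Real.rpow_add_one hx0.ne']
    congr 2
    · field_simp
    · rw [hx]
      field_simp
      ring
  rw [hterm]
  nlinarith
end

section
/- Let q be a positive integer and set u_{f,q}^I = −(q/(√2·(1+q)))^{1/(1+q)}. Then for every real u with u_{f,q}^I < u < 0, one has √2·q + 3·(−1)^q·(1+q)·u^{1+q} + √2·q·u^{2(1+q)} − √q·(1 + √2·(−1)^q·u^{1+q})·√( 2q + 2·(−1)^q·√2·(1+q)·u^{1+q} + q·u^{2(1+q)} ) ≠ 0, where √ denotes the real square root and (−1/(1+q))-th and (1/(1+q))-th powers are real powers. -/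
/-- With `s = √2 |u|^{1+q}`, the two terms of the normal component (times `√2`) cannot agree:
the difference of their squares vanishes only where the first term is negative. -/
lemma normal_component_ne_of_mem_Ioo {q s R : ℝ} (hq : 0 < q) (hs : 0 < s)
    (hsq : s * (1 + q) < q) (hR : 0 ≤ R) (hR2 : R ^ 2 = q * (4 * q - 4 * (1 + q) * s + q * s ^ 2)) :
    2 * q - 3 * (1 + q) * s + q * s ^ 2 ≠ (1 - s) * R := by
  intro h
  have hs1 : s < 1 := by nlinarith
  have hnonneg : 0 ≤ 2 * q - 3 * (1 + q) * s + q * s ^ 2 :=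
    h ▸ mul_nonneg (by linarith) hR
  have hsquare : (2 * q - 3 * (1 + q) * s + q * s ^ 2) ^ 2
      = (1 - s) ^ 2 * (q * (4 * q - 4 * (1 + q) * s + q * s ^ 2)) := by
    rw [h, mul_pow, hR2]
  have hroot : -8 * q + (9 + 10 * q) * s - 2 * q * s ^ 2 = 0 := by
    refine (mul_eq_zero.mp (?_ : s * _ = 0)).resolve_left hs.ne'
    linear_combination hsquare
  have hneg : 0 < s * (3 + 2 * q * (1 - s)) := by
    have : 0 < 1 - s := by linarith
    positivity
  nlinarith


/-- Transversality along `U₅`: for every positive integer `q` and every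
`u` with `u_{f,q}^I = -(q/(√2(1+q)))^{1/(1+q)} < u < 0`, the expression
`√2 q + 3(-1)^q (1+q) u^{1+q} + √2 q u^{2(1+q)}
  - √q (1 + √2 (-1)^q u^{1+q}) √(2q + 2(-1)^q √2 (1+q) u^{1+q} + q u^{2(1+q)})`
does not vanish. -/
theorem chazy_U5_transversal (q : ℕ) (hq : 1 ≤ q) :
    ∀ u : ℝ,
      -(((q : ℝ) / (Real.sqrt 2 * (1 + (q : ℝ)))) ^ ((1 : ℝ) / (1 + (q : ℝ)))) < u →
      u < 0 →
      Real.sqrt 2 * (q : ℝ) + 3 * (-1 : ℝ) ^ q * (1 + (q : ℝ)) * u ^ (1 + q)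
        + Real.sqrt 2 * (q : ℝ) * u ^ (2 * (1 + q))
        - Real.sqrt (q : ℝ) * (1 + Real.sqrt 2 * (-1 : ℝ) ^ q * u ^ (1 + q))
          * Real.sqrt (2 * (q : ℝ) + 2 * (-1 : ℝ) ^ q * Real.sqrt 2 * (1 + (q : ℝ)) * u ^ (1 + q)
              + (q : ℝ) * u ^ (2 * (1 + q))) ≠ 0 := by
  intro u hu hu0 h
  have hq0 : (0 : ℝ) < q := by exact_mod_cast hq
  have hr0 : 0 < Real.sqrt 2 := by positivity
  have hr2 : Real.sqrt 2 ^ 2 = 2 := Real.sq_sqrt (by norm_num)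
  have hw2 : Real.sqrt (q : ℝ) ^ 2 = q := Real.sq_sqrt hq0.le
  have ht0 : 0 < (-u) ^ (1 + q) := pow_pos (by linarith) _
  have htlt : (-u) ^ (1 + q) < (q : ℝ) / (Real.sqrt 2 * (1 + (q : ℝ))) := by
    have hpow := pow_lt_pow_left₀ (neg_lt.mp hu) (by linarith) (show 1 + q ≠ 0 by omega)
    rwa [one_div, show (1 + (q : ℝ)) = ((1 + q : ℕ) : ℝ) by push_cast; rfl,
      Real.rpow_inv_natCast_pow (by positivity) (by omega), Nat.cast_add, Nat.cast_one] at hpow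
  rw [lt_div_iff₀ (by positivity)] at htlt
  have htu : (-1 : ℝ) ^ q * u ^ (1 + q) = -(-u) ^ (1 + q) := by
    rw [neg_pow u, pow_add (-1 : ℝ) 1 q]
    ring
  have htu2 : u ^ (2 * (1 + q)) = ((-u) ^ (1 + q)) ^ 2 := by
    rw [← pow_mul, mul_comm (1 + q) 2, (even_two_mul (1 + q)).neg_pow]
  rw [htu2] at h
  generalize (-u) ^ (1 + q) = t at *
  set D := 2 * (q : ℝ) + 2 * (-1 : ℝ) ^ q * Real.sqrt 2 * (1 + (q : ℝ)) * u ^ (1 + q)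
    + (q : ℝ) * t ^ 2 with hD
  have hDt : D = 2 * q - 2 * Real.sqrt 2 * (1 + q) * t + q * t ^ 2 := by
    rw [hD]
    linear_combination 2 * Real.sqrt 2 * (1 + (q : ℝ)) * htu
  have hD0 : 0 ≤ D := by
    rw [hDt]
    nlinarith [mul_nonneg hq0.le (sq_nonneg t)]
  have hD2 : Real.sqrt D ^ 2 = D := Real.sq_sqrt hD0
  refine normal_component_ne_of_mem_Ioo (s := Real.sqrt 2 * t)
    (R := Real.sqrt 2 * Real.sqrt q * Real.sqrt D) hq0 (by positivity) (by linarith)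
    (by positivity) ?_ ?_
  · rw [mul_pow, mul_pow, hr2, hw2, hD2, hDt]
    linear_combination (-(q : ℝ) ^ 2 * t ^ 2) * hr2
  · linear_combination Real.sqrt 2 * h
      - (3 * Real.sqrt 2 * (1 + q) - Real.sqrt 2 ^ 2 * Real.sqrt q * Real.sqrt D) * htu
      - (q : ℝ) * hr2
end

section
/- Let q be a positive integer, set u_{i,q}^D = 2^{−1/(2(1+q))}(1+q)^{−1/(1+q)}, and define for real u: R(u) = 2q − 2^{(3+2q)/(2(1+q))}(1+q)^{(2+q)/(1+q)}·u + 2√2(1+q)·u^{1+q} + q·u^{2(1+q)}, and p₁(u) = √q·(√2 + 2u^{1+q})·√R(u) − 2q + 2^{1/(2(1+q))}(1+q)^{1/(1+q)}(3+2q)·u − 3√2(1+q)·u^{1+q} − 2q·u^{2(1+q)}, where √ is the real square root. Let P⁺ be the polynomial P⁺(u) = 2^{(5+4q)/(2(1+q))} q (1+q)^{1/(1+q)} (2+q) − 2^{1/(1+q)} (1+q)^{2/(1+q)} (3+2q)² u − 8√2 q u^q + 2^{(4+3q)/(2(1+q))} (1+q)^{(2+q)/(1+q)} (9+2q) u^{1+q}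 − 2(9+10q) u^{1+2q} + 2^{(5+4q)/(2(1+q))} q (1+q)^{1/(1+q)} u^{2(1+q)} − 4√2 q u^{2+3q}. If P⁺ has at most one root, counted with multiplicity, in the open interval (0, u_{i,q}^D), then p₁(u) ≠ 0 for every u with 0 < u ≤ u_{i,q}^D. -/
open Polynomial

/-- The radicand `R(u)` appearing in the normal component along `U₃`. -/
noncomputable def chazyR3 (q : ℕ) (u : ℝ) : ℝ :=
  2 * (q : ℝ) - (2 : ℝ) ^ ((3 + 2 * (q : ℝ)) / (2 * (1 + (q : ℝ))))
      * (1 + (q : ℝ)) ^ ((2 + (q : ℝ)) / (1 + (q : ℝ))) * u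
    + 2 * Real.sqrt 2 * (1 + (q : ℝ)) * u ^ (1 + q) + (q : ℝ) * u ^ (2 * (1 + q))

/-- The function `p₁(u)`, the normal component of `X̃_q^-` along `U₃`
up to the positive factor `(1+q)u^{q-1}/q`. -/
noncomputable def chazyP1fun (q : ℕ) (u : ℝ) : ℝ :=
  Real.sqrt (q : ℝ) * (Real.sqrt 2 + 2 * u ^ (1 + q)) * Real.sqrt (chazyR3 q u)
    - 2 * (q : ℝ)
    + (2 : ℝ) ^ ((1 : ℝ) / (2 * (1 + (q : ℝ)))) * (1 + (q : ℝ)) ^ ((1 : ℝ) / (1 + (q : ℝ)))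
        * (3 + 2 * (q : ℝ)) * u
    - 3 * Real.sqrt 2 * (1 + (q : ℝ)) * u ^ (1 + q)
    - 2 * (q : ℝ) * u ^ (2 * (1 + q))

/-- The reciprocal `2^{1/(2(1+q))} (1+q)^{1/(1+q)}` of the endpoint `chazyUiD q`. -/
noncomputable def chazyScale (q : ℕ) : ℝ :=
  (2 : ℝ) ^ ((1 : ℝ) / (2 * (1 + (q : ℝ)))) * (1 + (q : ℝ)) ^ ((1 : ℝ) / (1 + (q : ℝ)))

theorem chazyUiD_pos (q : ℕ) : 0 < chazyUiD q := by
  unfold chazyUiD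
  positivity

theorem chazyScale_pos (q : ℕ) : 0 < chazyScale q := by
  unfold chazyScale
  positivity

theorem chazyScale_mul_chazyUiD (q : ℕ) : chazyScale q * chazyUiD q = 1 := by
  have hn : (0 : ℝ) < 1 + q := by positivity
  unfold chazyScale chazyUiD
  rw [neg_div, neg_div, Real.rpow_neg zero_le_two, Real.rpow_neg hn.le]
  field_simp

theorem chazyScale_pow (q : ℕ) : chazyScale q ^ (1 + q) = √2 * (1 + q) := by
  have hn : (0 : ℝ) < 1 + q := by positivity
  unfold chazyScale
  rw [mul_pow, ← Real.rpow_natCast, ← Real.rpow_natCast, ← Real.rpow_mul zero_le_two,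
    ← Real.rpow_mul hn.le, Real.sqrt_eq_rpow]
  push_cast
  congr 1
  · congr 1
    field_simp
  · rw [one_div_mul_cancel hn.ne', Real.rpow_one]

theorem two_rpow_eq_mul_sqrt_two (q : ℕ) :
    (2 : ℝ) ^ ((4 + 3 * (q : ℝ)) / (2 * (1 + (q : ℝ))))
      = 2 * √2 * (2 : ℝ) ^ ((1 : ℝ) / (2 * (1 + (q : ℝ)))) := by
  have hn : (0 : ℝ) < 1 + q := by positivity
  rw [show (4 + 3 * (q : ℝ)) / (2 * (1 + (q : ℝ))) = 1 + 1 / 2 + 1 / (2 * (1 + (q : ℝ))) by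
    field_simp; ring, Real.rpow_add two_pos, Real.rpow_add two_pos, Real.rpow_one,
    Real.sqrt_eq_rpow]

theorem two_rpow_eq_four_mul (q : ℕ) :
    (2 : ℝ) ^ ((5 + 4 * (q : ℝ)) / (2 * (1 + (q : ℝ))))
      = 4 * (2 : ℝ) ^ ((1 : ℝ) / (2 * (1 + (q : ℝ)))) := by
  have hn : (0 : ℝ) < 1 + q := by positivity
  rw [show (5 + 4 * (q : ℝ)) / (2 * (1 + (q : ℝ))) = 1 + 1 + 1 / (2 * (1 + (q : ℝ))) by
    field_simp; ring, Real.rpow_add two_pos, Real.rpow_add two_pos, Real.rpow_one]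
  norm_num

theorem two_rpow_eq_two_mul (q : ℕ) :
    (2 : ℝ) ^ ((3 + 2 * (q : ℝ)) / (2 * (1 + (q : ℝ))))
      = 2 * (2 : ℝ) ^ ((1 : ℝ) / (2 * (1 + (q : ℝ)))) := by
  have hn : (0 : ℝ) < 1 + q := by positivity
  rw [show (3 + 2 * (q : ℝ)) / (2 * (1 + (q : ℝ))) = 1 + 1 / (2 * (1 + (q : ℝ))) by
    field_simp; ring, Real.rpow_add two_pos, Real.rpow_one]

theorem one_add_rpow_eq_mul (q : ℕ) :
    (1 + (q : ℝ)) ^ ((2 + (q : ℝ)) / (1 + (q : ℝ)))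
      = (1 + q) * (1 + (q : ℝ)) ^ ((1 : ℝ) / (1 + (q : ℝ))) := by
  have hn : (0 : ℝ) < 1 + q := by positivity
  rw [show (2 + (q : ℝ)) / (1 + (q : ℝ)) = 1 + 1 / (1 + (q : ℝ)) by
    field_simp; ring, Real.rpow_add hn, Real.rpow_one]

theorem chazyScale_sq (q : ℕ) :
    (2 : ℝ) ^ ((1 : ℝ) / (1 + (q : ℝ))) * (1 + (q : ℝ)) ^ ((2 : ℝ) / (1 + (q : ℝ)))
      = chazyScale q ^ 2 := by
  have hn : (0 : ℝ) < 1 + q := by positivity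
  unfold chazyScale
  rw [mul_pow, ← Real.rpow_mul_natCast zero_le_two, ← Real.rpow_mul_natCast hn.le]
  push_cast
  congr 2 <;> field_simp

theorem chazyR3_eq (q : ℕ) (u : ℝ) :
    chazyR3 q u = 2 * q - 2 * (1 + q) * (chazyScale q * u)
      + 2 * (chazyScale q * u) ^ (1 + q) + q * (u ^ (1 + q)) ^ 2 := by
  rw [mul_pow, chazyScale_pow]
  unfold chazyR3 chazyScale
  rw [two_rpow_eq_two_mul, one_add_rpow_eq_mul]
  ring

theorem chazyR3_pos {q : ℕ} (hq : 1 ≤ q) {u : ℝ} (hu : 0 < u) : 0 < chazyR3 q u := by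
  have hq' : (0 : ℝ) < q := by exact_mod_cast hq
  have hy : 0 < chazyScale q * u := mul_pos (chazyScale_pos q) hu
  have bernoulli := one_add_mul_le_pow (a := chazyScale q * u - 1) (by linarith) (1 + q)
  rw [add_sub_cancel] at bernoulli
  push_cast at bernoulli
  have : 0 < (q : ℝ) * (u ^ (1 + q)) ^ 2 := by positivity
  rw [chazyR3_eq]
  nlinarith

/-- The part of `chazyP1fun` which does not involve the square root of the radicand. -/
noncomputable def chazyP1rest (q : ℕ) (u : ℝ) : ℝ :=
  - 2 * q + chazyScale q * (3 + 2 * q) * u - 3 * √2 * (1 + q) * u ^ (1 + q)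
    - 2 * q * (u ^ (1 + q)) ^ 2

/-- The part of `chazyP1fun` containing the square root of the radicand. -/
noncomputable def chazyP1root (q : ℕ) (u : ℝ) : ℝ :=
  √q * (√2 + 2 * u ^ (1 + q)) * √(chazyR3 q u)

theorem chazyP1fun_eq (q : ℕ) (u : ℝ) :
    chazyP1fun q u = chazyP1root q u + chazyP1rest q u := by
  unfold chazyP1fun chazyP1root chazyP1rest chazyScale
  ring

theorem chazyP1root_pos {q : ℕ} (hq : 1 ≤ q) {u : ℝ} (hu : 0 < u) : 0 < chazyP1root q u := by
  have hq' : (0 : ℝ) < q := by exact_mod_cast hq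
  have := chazyR3_pos hq hu
  unfold chazyP1root
  positivity

theorem continuous_chazyP1root (q : ℕ) : Continuous (chazyP1root q) := by
  unfold chazyP1root chazyR3
  fun_prop

theorem continuous_chazyP1rest (q : ℕ) : Continuous (chazyP1rest q) := by
  unfold chazyP1rest
  fun_prop

theorem continuous_chazyP1fun (q : ℕ) : Continuous (chazyP1fun q) := by
  rw [funext (chazyP1fun_eq q)]
  exact (continuous_chazyP1root q).add (continuous_chazyP1rest q)

theorem chazyP1fun_chazyUiD_pos {q : ℕ} (hq : 1 ≤ q) : 0 < chazyP1fun q (chazyUiD q) := by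
  have hq' : (0 : ℝ) < q := by exact_mod_cast hq
  have hw : 0 < chazyUiD q ^ (1 + q) := pow_pos (chazyUiD_pos q) _
  have hcw : √2 * (1 + q) * chazyUiD q ^ (1 + q) = 1 := by
    rw [← chazyScale_pow, ← mul_pow, chazyScale_mul_chazyUiD, one_pow]
  have hR : √(chazyR3 q (chazyUiD q)) = √q * chazyUiD q ^ (1 + q) := by
    rw [chazyR3_eq, chazyScale_mul_chazyUiD, one_pow]
    rw [show 2 * (q : ℝ) - 2 * (1 + q) * 1 + 2 * 1 + q * (chazyUiD q ^ (1 + q)) ^ 2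
      = q * (chazyUiD q ^ (1 + q)) ^ 2 by ring, Real.sqrt_mul hq'.le, Real.sqrt_sq hw.le]
  have key : chazyP1fun q (chazyUiD q) = q * √2 * chazyUiD q ^ (1 + q) := by
    rw [chazyP1fun_eq, chazyP1root, chazyP1rest, hR]
    linear_combination (√2 + 2 * chazyUiD q ^ (1 + q)) * chazyUiD q ^ (1 + q)
      * Real.sq_sqrt hq'.le + (3 + 2 * (q : ℝ)) * chazyScale_mul_chazyUiD q - 3 * hcw
  rw [key]
  positivity

theorem chazyPplus_eval (q : ℕ) (u : ℝ) :
    (chazyPplus q).eval u = 4 * q * chazyScale q * (2 + q)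
      - chazyScale q ^ 2 * (3 + 2 * q) ^ 2 * u - 8 * √2 * q * u ^ q
      + 2 * √2 * chazyScale q * (1 + q) * (9 + 2 * q) * u ^ (1 + q)
      - 2 * (9 + 10 * q) * u ^ (1 + 2 * q) + 4 * q * chazyScale q * u ^ (2 * (1 + q))
      - 4 * √2 * q * u ^ (2 + 3 * q) := by
  unfold chazyPplus
  rw [chazyScale_sq, two_rpow_eq_four_mul, two_rpow_eq_mul_sqrt_two, one_add_rpow_eq_mul]
  simp only [eval_add, eval_sub, eval_mul, eval_C, eval_pow, eval_X]
  unfold chazyScale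
  ring

/-- Eliminating the square root from `chazyP1fun` gives `chazyPplus`. -/
theorem chazyPplus_eval_mul {q : ℕ} (hq : 1 ≤ q) {u : ℝ} (hu : 0 < u) :
    u * (chazyPplus q).eval u
      = chazyP1fun q u * (chazyP1root q u - chazyP1rest q u) := by
  have hs : √2 ^ 2 = (2 : ℝ) := Real.sq_sqrt zero_le_two
  have hroot : chazyP1root q u ^ 2 = q * (√2 + 2 * u ^ (1 + q)) ^ 2 * chazyR3 q u := by
    rw [chazyP1root, mul_pow, mul_pow, Real.sq_sqrt q.cast_nonneg,
      Real.sq_sqrt (chazyR3_pos hq hu).le]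
  have hsq : chazyP1fun q u * (chazyP1root q u - chazyP1rest q u)
      = chazyP1root q u ^ 2 - chazyP1rest q u ^ 2 := by
    rw [chazyP1fun_eq]
    ring
  rw [hsq, hroot, chazyR3_eq, chazyP1rest, chazyPplus_eval, mul_pow, chazyScale_pow]
  have hw : u ^ (1 + q) = u * u ^ q := by ring
  have hw2 : u ^ (1 + 2 * q) = u * (u ^ q) ^ 2 := by ring
  have hw3 : u ^ (2 * (1 + q)) = u ^ 2 * (u ^ q) ^ 2 := by ring
  have hw4 : u ^ (2 + 3 * q) = u ^ 2 * (u ^ q) ^ 3 := by ring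
  rw [hw, hw2, hw3, hw4]
  generalize u ^ q = v
  generalize √(2 : ℝ) = s at *
  generalize chazyScale q = c
  generalize (q : ℝ) = r
  linear_combination -(r * (2 * r - 2 * (1 + r) * c * u + 2 * s * (1 + r) * (u * v) + r * (u * v) ^ 2)
    + 8 * r * (1 + r) * (u * v) ^ 2 - 9 * (1 + r) ^ 2 * (u * v) ^ 2) * hs

theorem chazyPplus_eval_zero_pos {q : ℕ} (hq : 1 ≤ q) : 0 < (chazyPplus q).eval 0 := by
  have hq' : (0 : ℝ) < q := by exact_mod_cast hq
  have := chazyScale_pos q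
  rw [chazyPplus_eval]
  simp [show q ≠ 0 by omega]
  positivity

/-- A polynomial which is positive at `0` and has at most one root in `(0, a)`, counted with
multiplicity, is negative on `(0, a)` after that root. -/
theorem Polynomial.eval_neg_of_card_roots_le_one {P : ℝ[X]} {a x y : ℝ} (h0 : 0 < P.eval 0)
    (hP : (P.roots.filter (fun u => 0 < u ∧ u < a)).card ≤ 1)
    (hx : 0 < x) (hroot : P.eval x = 0) (hxy : x < y) (hya : y < a) : P.eval y < 0 := by
  obtain ⟨Q, rfl⟩ := dvd_iff_isRoot.mpr hroot
  have hne : (X - C x) * Q ≠ 0 := by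
    intro h
    simp [h] at h0
  rw [roots_mul hne, roots_X_sub_C, Multiset.singleton_add,
    Multiset.filter_cons_of_pos _ ⟨hx, hxy.trans hya⟩, Multiset.card_cons] at hP
  have hQ : ∀ z, 0 < z → z < a → Q.eval z ≠ 0 := by
    intro z hz hza hzero
    have hmem : z ∈ Q.roots.filter (fun u => 0 < u ∧ u < a) :=
      Multiset.mem_filter.mpr ⟨(mem_roots (right_ne_zero_of_mul hne)).mpr hzero, hz, hza⟩
    have := Multiset.card_pos_iff_exists_mem.mpr ⟨z, hmem⟩
    omega
  simp only [eval_mul, eval_sub, eval_X, eval_C] at h0 ⊢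
  have hQ0 : Q.eval 0 < 0 := by
    by_contra! h
    nlinarith [mul_nonneg hx.le h]
  have hQy : Q.eval y < 0 := by
    by_contra! h
    obtain ⟨z, hz, hzero⟩ := intermediate_value_Icc (hx.trans hxy).le
      (f := fun z => Q.eval z) Q.continuous.continuousOn ⟨hQ0.le, h⟩
    refine hQ z (hz.1.lt_of_ne ?_) (hz.2.trans_lt hya) hzero
    rintro rfl
    exact hQ0.ne hzero
  exact mul_neg_of_pos_of_neg (sub_pos.mpr hxy) hQy

/-- Proposition 4.3: if `P⁺` has at most one root, counted with multiplicity, in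
`(0, u_{i,q}^D)`, then `p₁` does not vanish on `(0, u_{i,q}^D]`. -/
theorem chazy_U3_transversal (q : ℕ) (hq : 1 ≤ q)
    (hC2 : (((chazyPplus q).roots).filter
      (fun u => 0 < u ∧ u < chazyUiD q)).card ≤ 1) :
    ∀ u : ℝ, 0 < u → u ≤ chazyUiD q → chazyP1fun q u ≠ 0 := by
  intro u hu hua hzero
  have hend := chazyP1fun_chazyUiD_pos hq
  have hlt : u < chazyUiD q := hua.lt_of_ne (by rintro rfl; exact hend.ne' hzero)
  have hPu : (chazyPplus q).eval u = 0 := by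
    have := chazyPplus_eval_mul hq hu
    rw [hzero, zero_mul] at this
    exact (mul_eq_zero.mp this).resolve_left hu.ne'
  have hneg : ∀ y, u < y → y < chazyUiD q → (chazyPplus q).eval y < 0 := fun y hy hya =>
    eval_neg_of_card_roots_le_one (chazyPplus_eval_zero_pos hq) hC2 hu hPu hy hya
  have hconj : 0 < chazyP1root q u - chazyP1rest q u := by
    have := chazyP1root_pos hq hu
    have := chazyP1fun_eq q u
    linarith
  have hev : ∀ᶠ y in nhdsWithin u (Set.Ioi u), 0 < chazyP1root q y - chazyP1rest q y :=
    nhdsWithin_le_nhds (((continuous_chazyP1root q).sub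
      (continuous_chazyP1rest q)).continuousAt.eventually_const_lt hconj)
  obtain ⟨y, hy, huy, hya⟩ := (hev.and (Ioo_mem_nhdsGT hlt)).exists
  have hy0 : 0 < y := hu.trans huy
  have hp1y : chazyP1fun q y < 0 := by
    have := chazyPplus_eval_mul hq hy0
    have := mul_neg_of_pos_of_neg hy0 (hneg y huy hya)
    by_contra! h
    nlinarith [mul_nonneg h hy.le]
  obtain ⟨z, hz, hz0⟩ := intermediate_value_Icc hya.le
    (continuous_chazyP1fun q).continuousOn ⟨hp1y.le, hend.le⟩
  have hzlt : z < chazyUiD q := hz.2.lt_of_ne (by rintro rfl; exact hend.ne' hz0)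
  have hz_pos : 0 < z := hy0.trans_le hz.1
  have hPz := chazyPplus_eval_mul hq hz_pos
  rw [hz0, zero_mul] at hPz
  exact (mul_neg_of_pos_of_neg hz_pos (hneg z (huy.trans_le hz.1) hzlt)).ne hPz
end

section
/- The real polynomial p₀(u) = −14 + 95u − (745/4)u² + 110u³ − 19u⁴ + 20u⁵ − 8u⁶ has no real zero in the open interval (2, 5/2). -/
/-- The polynomial `p₀(u) = -14 + 95u - (745/4)u² + 110u³ - 19u⁴ + 20u⁵ - 8u⁶`
has no real zero in the open interval `(2, 5/2)`. -/
theorem chazy_q1_sturm_p0 :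
    ∀ u ∈ Set.Ioo (2 : ℝ) (5 / 2),
      -14 + 95 * u - (745 / 4) * u ^ 2 + 110 * u ^ 3 - 19 * u ^ 4
        + 20 * u ^ 5 - 8 * u ^ 6 ≠ 0 := by
  rintro u ⟨h₁, h₂⟩
  have hx : 0 < u - 2 := sub_pos.mpr h₁
  have hy : 0 < 5 / 2 - u := sub_pos.mpr h₂
  -- All Bernstein coefficients on `[2, 5/2]` are positive.
  have bernstein : -14 + 95 * u - (745 / 4) * u ^ 2 + 110 * u ^ 3 - 19 * u ^ 4
        + 20 * u ^ 5 - 8 * u ^ 6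
      = 8640 * (5 / 2 - u) ^ 6 + 55872 * (u - 2) * (5 / 2 - u) ^ 5
        + 144924 * (u - 2) ^ 2 * (5 / 2 - u) ^ 4 + 189600 * (u - 2) ^ 3 * (5 / 2 - u) ^ 3
        + 127180 * (u - 2) ^ 4 * (5 / 2 - u) ^ 2 + 37584 * (u - 2) ^ 5 * (5 / 2 - u)
        + 2304 * (u - 2) ^ 6 := by
    ring
  rw [bernstein]
  positivity
end

section
/- The real polynomial p₃(u) = 12·2^{3/4} − 58√2·u + 88·2^{1/4}·u² − 38u³ + 4·2^{3/4}·u⁴ − 4√2·u⁵ has exactly one real zero in (0, ∞), and that zero is simple; and the real polynomial p₄(u) = 12·2^{3/4} − 42√2·u − 88·2^{1/4}·u² − 38u³ + 4·2^{3/4}·u⁴ + 4√2·u⁵ has exactly one real zero in (−∞, 0), and that zero is simple. -/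
/-- The polynomial `p₃(u) = 12·2^{3/4} - 58√2 u + 88·2^{1/4} u² - 38u³ + 4·2^{3/4} u⁴ - 4√2 u⁵`. -/
noncomputable def chazyp3 (u : ℝ) : ℝ :=
  12 * (2 : ℝ) ^ ((3 : ℝ) / 4) - 58 * Real.sqrt 2 * u
    + 88 * (2 : ℝ) ^ ((1 : ℝ) / 4) * u ^ 2 - 38 * u ^ 3
    + 4 * (2 : ℝ) ^ ((3 : ℝ) / 4) * u ^ 4 - 4 * Real.sqrt 2 * u ^ 5

/-- The polynomial `p₄(u) = 12·2^{3/4} - 42√2 u - 88·2^{1/4} u² - 38u³ + 4·2^{3/4} u⁴ + 4√2 u⁵`. -/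
noncomputable def chazyp4 (u : ℝ) : ℝ :=
  12 * (2 : ℝ) ^ ((3 : ℝ) / 4) - 42 * Real.sqrt 2 * u
    - 88 * (2 : ℝ) ^ ((1 : ℝ) / 4) * u ^ 2 - 38 * u ^ 3
    + 4 * (2 : ℝ) ^ ((3 : ℝ) / 4) * u ^ 4 + 4 * Real.sqrt 2 * u ^ 5

/-- A function that is positive on `(0, 1]`, has negative derivative on `[1, ∞)` and takes a
negative value at `2` has exactly one positive zero, and its derivative there is nonzero. -/
lemma exists_unique_pos_simple_zero {q q' : ℝ → ℝ} (hd : ∀ x, HasDerivAt q (q' x) x)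
    (hpos : ∀ x, 0 < x → x ≤ 1 → 0 < q x) (hneg : ∀ x, 1 ≤ x → q' x < 0) (h2 : q 2 < 0) :
    ∃ x, 0 < x ∧ q x = 0 ∧ q' x ≠ 0 ∧ ∀ y, 0 < y → q y = 0 → y = x := by
  have hc : Continuous q := continuous_iff_continuousAt.2 fun x => (hd x).continuousAt
  have hanti : StrictAntiOn q (Set.Ici 1) := by
    refine strictAntiOn_of_deriv_neg (convex_Ici 1) hc.continuousOn fun x hx => ?_
    rw [interior_Ici] at hx
    rw [(hd x).deriv]
    exact hneg x (le_of_lt hx)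
  obtain ⟨x, hx, hx0⟩ := intermediate_value_Icc' (by norm_num : (1 : ℝ) ≤ 2) hc.continuousOn
    (⟨h2.le, (hpos 1 one_pos le_rfl).le⟩ : (0 : ℝ) ∈ Set.Icc (q 2) (q 1))
  refine ⟨x, by linarith [hx.1], hx0, (hneg x hx.1).ne, fun y hy hy0 => ?_⟩
  have hy1 : 1 ≤ y := by
    by_contra! h
    exact (hpos y hy h.le).ne' hy0
  exact hanti.injOn hy1 hx.1 (hy0.trans hx0.symm)

/-- Simple zeros are preserved by rescaling the argument and the value. -/
lemma deriv_ne_zero_of_rescale {f q : ℝ → ℝ} {q' a k x : ℝ} (ha : a ≠ 0) (hk : k ≠ 0)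
    (hf : ∀ s, f (a * s) = k * q s) (hd : HasDerivAt q q' x) (hq : q' ≠ 0) :
    deriv f (a * x) ≠ 0 := by
  have hfq : f = fun u => k * q (u / a) := by
    funext u
    rw [← hf, mul_div_cancel₀ u ha]
  have hx : a * x / a = x := mul_div_cancel_left₀ x ha
  have h : HasDerivAt f (k * (q' * (1 / a))) (a * x) := by
    rw [hfq]
    exact (HasDerivAt.comp (a * x) (by rwa [hx]) ((hasDerivAt_id _).div_const a)).const_mul k
  rw [h.deriv]
  exact mul_ne_zero hk (mul_ne_zero hq (one_div_ne_zero ha))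

lemma hasDerivAt_quintic (a b c d e f x : ℝ) :
    HasDerivAt (fun s : ℝ => a + b * s + c * s ^ 2 + d * s ^ 3 + e * s ^ 4 + f * s ^ 5)
      (b + 2 * c * x + 3 * d * x ^ 2 + 4 * e * x ^ 3 + 5 * f * x ^ 4) x := by
  have h := ((((((hasDerivAt_id x).const_mul b).const_add a).add
    ((hasDerivAt_pow 2 x).const_mul c)).add ((hasDerivAt_pow 3 x).const_mul d)).add
    ((hasDerivAt_pow 4 x).const_mul e)).add ((hasDerivAt_pow 5 x).const_mul f)
  refine h.congr_deriv ?_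
  push_cast
  ring

lemma exists_fourth_root_two : ∃ t : ℝ, 0 < t ∧ t ^ 4 = 2 ∧ (2 : ℝ) ^ ((1 : ℝ) / 4) = t ∧
    Real.sqrt 2 = t ^ 2 ∧ (2 : ℝ) ^ ((3 : ℝ) / 4) = t ^ 3 := by
  refine ⟨(2 : ℝ) ^ ((1 : ℝ) / 4), by positivity, ?_, rfl, ?_, ?_⟩
  · rw [← Real.rpow_mul_natCast (by norm_num)]
    norm_num
  · rw [Real.sqrt_eq_rpow, ← Real.rpow_mul_natCast (by norm_num)]
    norm_num
  · rw [← Real.rpow_mul_natCast (by norm_num)]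
    norm_num

/-- `p₃` has exactly one real zero in `(0, ∞)`, and it is simple; `p₄` has
exactly one real zero in `(-∞, 0)`, and it is simple. -/
theorem chazy_q1_sturm_p3_p4 :
    (∃ u : ℝ, 0 < u ∧ chazyp3 u = 0 ∧ deriv chazyp3 u ≠ 0 ∧
      ∀ v : ℝ, 0 < v → chazyp3 v = 0 → v = u) ∧
    (∃ u : ℝ, u < 0 ∧ chazyp4 u = 0 ∧ deriv chazyp4 u ≠ 0 ∧
      ∀ v : ℝ, v < 0 → chazyp4 v = 0 → v = u) := by
  obtain ⟨t, ht, ht4, h1, h2, h3⟩ := exists_fourth_root_two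
  have hk : 2 * t ^ 3 ≠ 0 := by positivity
  constructor
  · have hf (s : ℝ) : chazyp3 (t * s) = 2 * t ^ 3 *
        (6 + -29 * s + 44 * s ^ 2 + -19 * s ^ 3 + 4 * s ^ 4 + -4 * s ^ 5) := by
      simp only [chazyp3, h1, h2, h3]
      linear_combination (4 * t ^ 3 * s ^ 4 - 4 * t ^ 3 * s ^ 5) * ht4
    obtain ⟨x, hx, hx0, hx', huniq⟩ := exists_unique_pos_simple_zero
      (hasDerivAt_quintic 6 (-29) 44 (-19) 4 (-4))
      (fun x h0 h1 => by
        have hcubic : 0 < 6 - 29 * x + 44 * x ^ 2 - 19 * x ^ 3 := by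
          nlinarith [mul_nonneg (sub_nonneg.2 h1) (sq_nonneg (x - 12 / 25)),
            mul_nonneg h0.le (sq_nonneg (x - 12 / 25)), sq_nonneg (x - 12 / 25)]
        nlinarith [mul_nonneg (pow_nonneg h0.le 4) (sub_nonneg.2 h1)])
      (fun x h => by
        obtain ⟨y, rfl⟩ : ∃ y, x = 1 + y := ⟨x - 1, by ring⟩
        have hy : 0 ≤ y := by linarith
        nlinarith [pow_nonneg hy 2, pow_nonneg hy 3, pow_nonneg hy 4])
      (by norm_num)
    refine ⟨t * x, mul_pos ht hx, by rw [hf, hx0, mul_zero],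
      deriv_ne_zero_of_rescale ht.ne' hk hf (hasDerivAt_quintic _ _ _ _ _ _ x) hx',
      fun v hv hv0 => ?_⟩
    obtain ⟨y, rfl⟩ : ∃ y, v = t * y := ⟨v / t, (mul_div_cancel₀ v ht.ne').symm⟩
    rw [hf] at hv0
    rw [huniq y (pos_of_mul_pos_right hv ht.le) ((mul_eq_zero.1 hv0).resolve_left hk)]
  · have hf (s : ℝ) : chazyp4 (-t * s) = 2 * t ^ 3 *
        (6 + 21 * s + -44 * s ^ 2 + 19 * s ^ 3 + 4 * s ^ 4 + -4 * s ^ 5) := by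
      simp only [chazyp4, h1, h2, h3]
      linear_combination (4 * t ^ 3 * s ^ 4 - 4 * t ^ 3 * s ^ 5) * ht4
    obtain ⟨x, hx, hx0, hx', huniq⟩ := exists_unique_pos_simple_zero
      (hasDerivAt_quintic 6 21 (-44) 19 4 (-4))
      (fun x h0 h1 => by
        have hcubic : 0 ≤ (1 - x) * (4 + 25 * x - 19 * x ^ 2) :=
          mul_nonneg (by linarith) (by nlinarith)
        nlinarith [mul_nonneg (pow_nonneg h0.le 4) (sub_nonneg.2 h1)])
      (fun x h => by
        obtain ⟨y, rfl⟩ : ∃ y, x = 1 + y := ⟨x - 1, by ring⟩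
        have hy : 0 ≤ y := by linarith
        nlinarith [pow_nonneg hy 2, pow_nonneg hy 3, pow_nonneg hy 4])
      (by norm_num)
    have ht' : -t ≠ 0 := neg_ne_zero.2 ht.ne'
    refine ⟨-t * x, by nlinarith, by rw [hf, hx0, mul_zero],
      deriv_ne_zero_of_rescale ht' hk hf (hasDerivAt_quintic _ _ _ _ _ _ x) hx',
      fun v hv hv0 => ?_⟩
    obtain ⟨y, rfl⟩ : ∃ y, v = -t * y := ⟨v / -t, (mul_div_cancel₀ v ht').symm⟩
    rw [hf] at hv0
    rw [huniq y (by nlinarith) ((mul_eq_zero.1 hv0).resolve_left hk)]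
end
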